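/- arXiv:2412.19728 — 3 statements merged into one kernel-verified Lean document; each statement's English description precedes it below -/
import Mathlib

section
/- Let ν ≥ 2 be an integer and let P(X) = c_ν X^ν + c_{ν−1} X^{ν−1} + ⋯ + c_1 X ∈ ℤ[X] be a polynomial with nonzero discriminant, and let J be the number of distinct irreducible factors of P over ℤ[X]. Then there exist positive constants C₁, C₂ depending only on P such that for all integers Q ≥ 2, C₁/Q ≤ D_{N_{Q,P}}(F_{Q,P}) ≤ C₂·(log Q)^J / Q, where N_{Q,P} = #F_{Q,P} and D denotes the discrepancy of the finite set F_{Q,P}. -/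
open Finset Filter

/-- The pairs `(a, q)` with `1 ≤ a ≤ q ≤ Q` and `gcd (P(a), q) = 1`, indexing the
polynomial Farey fractions `a / q` of order `Q`. -/
def fareyPairs (P : Polynomial ℤ) (Q : ℕ) : Finset (ℕ × ℕ) :=
  (Finset.Icc 1 Q ×ˢ Finset.Icc 1 Q).filter
    (fun x => x.1 ≤ x.2 ∧ Int.gcd (P.eval (x.1 : ℤ)) (x.2 : ℤ) = 1)

/-- The set of polynomial Farey fractions of order `Q`. -/
def fareySet (P : Polynomial ℤ) (Q : ℕ) : Finset ℚ :=
  (fareyPairs P Q).image (fun x => (x.1 : ℚ) / (x.2 : ℚ))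

/-- `f_P(m)` is the number of `1 ≤ d ≤ m` with `P(d) ≡ 0 (mod m)`. -/
def fP (P : Polynomial ℤ) (m : ℕ) : ℕ :=
  ((Finset.Icc 1 m).filter (fun d : ℕ => (m : ℤ) ∣ P.eval (d : ℤ))).card

/-- `β_P = ∏_p (1 - f_P(p)/p²)`, the product over all primes. -/
noncomputable def betaP (P : Polynomial ℤ) : ℝ :=
  ∏' p : Nat.Primes, (1 - (fP P (p : ℕ) : ℝ) / ((p : ℕ) : ℝ) ^ 2)

open scoped Classical in
/-- Pair correlation measure `S_F(Λ)` of a finite set `F ⊂ ℝ/ℤ` (represented by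
rationals): `(1/N) · #{(a,b) ∈ F² : a ≠ b, a - b ∈ (1/N)(0,Λ) + ℤ}`. -/
noncomputable def pairCorr (F : Finset ℚ) (Λ : ℝ) : ℝ :=
  (((F ×ˢ F).filter (fun x => x.1 ≠ x.2 ∧
      ∃ k : ℤ, ((x.1 : ℝ) - (x.2 : ℝ) - (k : ℝ)) * (F.card : ℝ) ∈ Set.Ioo 0 Λ)).card : ℝ) /
    (F.card : ℝ)

/-- The number of distinct irreducible factors of `P`, counted as the number of
monic irreducible rational polynomials dividing `P` over `ℚ`. -/
noncomputable def numIrredFactors (P : Polynomial ℤ) : ℕ :=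
  Nat.card {q : Polynomial ℚ // q.Monic ∧ Irreducible q ∧ q ∣ P.map (Int.castRingHom ℚ)}

open scoped Classical in
/-- The discrepancy `D_{N_{Q,P}}(F_{Q,P}) = sup_{0 ≤ α ≤ 1} |A(α)/N - α|`. -/
noncomputable def discrepancy (P : Polynomial ℤ) (Q : ℕ) : ℝ :=
  ⨆ α : Set.Icc (0 : ℝ) 1,
    |(((fareyPairs P Q).filter (fun x => ((x.1 : ℝ) / (x.2 : ℝ)) ≤ (α : ℝ))).card : ℝ) /
        ((fareyPairs P Q).card : ℝ) - (α : ℝ)|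


section NF
open Polynomial NumberField

theorem nf_exists_M (K : Type) [Field K] [NumberField K] (θ : K)
    (hgen : ∀ x : K, ∃ b : ℤ, b ≠ 0 ∧ ∃ F : ℤ[X], (b : K) * x = aeval θ F) :
    ∃ M : ℤ, M ≠ 0 ∧ ∀ x : 𝓞 K, ∃ F : ℤ[X], (M : K) * (x : K) = aeval θ F := by
  classical
  obtain ⟨S, hS⟩ := (Module.Finite.fg_top : (⊤ : Submodule ℤ (𝓞 K)).FG)
  choose b hb F hF using hgen
  refine ⟨∏ s ∈ S, b (s : K), Finset.prod_ne_zero_iff.2 fun s _ => hb _, fun x => ?_⟩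
  have hx : x ∈ Submodule.span ℤ (S : Set (𝓞 K)) := by rw [hS]; trivial
  induction hx using Submodule.span_induction with
  | mem x hx =>
    refine ⟨C (∏ s ∈ S.erase x, b (s : K)) * F x, ?_⟩
    rw [map_mul, ← hF, ← Finset.mul_prod_erase S (fun s => b (s : K)) (by exact_mod_cast hx)]
    simp
    ring
  | zero => exact ⟨0, by simp⟩
  | add x y _ _ hx hy =>
    obtain ⟨F1, h1⟩ := hx
    obtain ⟨F2, h2⟩ := hy
    refine ⟨F1 + F2, ?_⟩
    rw [map_add, ← h1, ← h2]
    push_cast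
    ring
  | smul a x _ hx =>
    obtain ⟨F1, h1⟩ := hx
    refine ⟨C a * F1, ?_⟩
    rw [map_mul, ← h1]
    simp
    ring

theorem nf_hom (K : Type) [Field K] [NumberField K] (θ : K) (G : ℤ[X])
    (hker : ∀ F : ℤ[X], aeval θ F = 0 → G ∣ F) (M : ℤ)
    (hM : ∀ x : 𝓞 K, ∃ F : ℤ[X], (M : K) * (x : K) = aeval θ F)
    (M' : ℤ) (η : 𝓞 K) (hη : (η : K) = M' * θ)
    (d : ℕ) (hd : IsUnit ((M : ZMod d))) (a : ℕ) (ha : (d : ℤ) ∣ G.eval (a : ℤ)) :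
    ∃ ψ : 𝓞 K →+* ZMod d, ψ η = (M' : ZMod d) * a := by
  have hk : ∀ F F' : ℤ[X], aeval θ F = aeval θ F' →
      ((F.eval (a : ℤ) : ℤ) : ZMod d) = ((F'.eval (a : ℤ) : ℤ) : ZMod d) := by
    intro F F' h
    have h1 : G ∣ F - F' := hker _ (by rw [map_sub, h, sub_self])
    obtain ⟨H, hH⟩ := h1
    have h2 : F.eval (a : ℤ) - F'.eval (a : ℤ) = G.eval (a : ℤ) * H.eval (a : ℤ) := by
      rw [← eval_sub, hH, eval_mul]
    rw [← sub_eq_zero, ← Int.cast_sub, h2]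
    rw [ZMod.intCast_zmod_eq_zero_iff_dvd]
    exact ha.mul_right _
  choose F hF using hM
  obtain ⟨u, hu⟩ := hd
  have hu1 : (↑u⁻¹ : ZMod d) * (M : ZMod d) = 1 := by rw [← hu]; simp
  refine ⟨{ toFun := fun x => (↑u⁻¹ : ZMod d) * (((F x).eval (a : ℤ) : ℤ) : ZMod d)
            map_one' := ?_, map_mul' := ?_, map_zero' := ?_, map_add' := ?_ }, ?_⟩
  · rw [hk (F 1) (C M) (by rw [← hF]; simp)]
    simpa using hu1
  · intro x y
    have := hk (C M * F (x * y)) (F x * F y) (by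
      rw [map_mul, map_mul, ← hF, ← hF, ← hF]; simp; ring)
    simp only [eval_mul, eval_C, Int.cast_mul] at this
    calc (↑u⁻¹ : ZMod d) * (((F (x*y)).eval (a : ℤ) : ℤ) : ZMod d)
        = (↑u⁻¹ : ZMod d) * ((↑u⁻¹ : ZMod d) * (M : ZMod d)) * (((F (x*y)).eval (a : ℤ) : ℤ) : ZMod d) := by
          rw [hu1]; ring
      _ = (↑u⁻¹ : ZMod d) * (↑u⁻¹ : ZMod d) * ((M : ZMod d) * (((F (x*y)).eval (a : ℤ) : ℤ) : ZMod d)) := by ring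
      _ = _ := by rw [this]; ring
  · show (↑u⁻¹ : ZMod d) * (((F 0).eval (a : ℤ) : ℤ) : ZMod d) = 0
    rw [hk (F 0) 0 (by rw [← hF]; simp)]
    simp
  · intro x y
    show (↑u⁻¹ : ZMod d) * (((F (x+y)).eval (a : ℤ) : ℤ) : ZMod d) = _
    rw [hk (F (x+y)) (F x + F y) (by rw [map_add, ← hF, ← hF, ← hF]; push_cast; ring)]
    rw [eval_add]; push_cast; ring
  · show (↑u⁻¹ : ZMod d) * (((F η).eval (a : ℤ) : ℤ) : ZMod d) = _
    rw [hk (F η) (C M * (C M' * X)) (by rw [← hF, hη]; simp)]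
    simp only [eval_mul, eval_C, eval_X, Int.cast_mul, Int.cast_natCast]
    rw [← mul_assoc, hu1, one_mul]

theorem nf_roots_le (K : Type) [Field K] [NumberField K] (θ : K) (G : ℤ[X])
    (hker : ∀ F : ℤ[X], aeval θ F = 0 → G ∣ F)
    (hgen : ∀ x : K, ∃ b : ℤ, b ≠ 0 ∧ ∃ F : ℤ[X], (b : K) * x = aeval θ F) :
    ∃ M : ℕ, M ≠ 0 ∧ ∀ d : ℕ, 0 < d → d.Coprime M →
      ((Finset.range d).filter (fun a : ℕ => (d : ℤ) ∣ G.eval (a : ℤ))).card ≤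
        Nat.card {I : Ideal (𝓞 K) // Ideal.absNorm I = d} := by
  obtain ⟨M, hM0, hM⟩ := nf_exists_M K θ hgen
  obtain ⟨M', hM'0, hM'⟩ : ∃ M' : ℤ, M' ≠ 0 ∧ IsIntegral ℤ ((M' : K) * θ) := by
    have : IsAlgebraic ℤ θ := by
      have h1 : IsAlgebraic ℚ θ := Algebra.IsAlgebraic.isAlgebraic θ
      exact (IsFractionRing.isAlgebraic_iff ℤ ℚ K).2 h1
    obtain ⟨y, hy0, hy⟩ := this.exists_integral_multiple
    exact ⟨y, hy0, by simpa [Algebra.smul_def] using hy⟩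
  refine ⟨(M * M').natAbs, by simp [hM0, hM'0], fun d hd hdM => ?_⟩
  have : NeZero d := ⟨hd.ne'⟩
  have hun : IsUnit ((M * M' : ℤ) : ZMod d) := by
    rw [ZMod.coe_int_isUnit_iff_isCoprime, Int.isCoprime_iff_gcd_eq_one]
    simpa [Int.gcd] using hdM
  rw [Int.cast_mul, IsUnit.mul_iff] at hun
  let η : 𝓞 K := ⟨(M' : K) * θ, hM'⟩
  have key : ∀ a : ℕ, (d : ℤ) ∣ G.eval (a : ℤ) → ∃ ψ : 𝓞 K →+* ZMod d, ψ η = (M' : ZMod d) * a :=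
    fun a ha => nf_hom K θ G hker M hM M' η rfl d hun.1 a ha
  have : Finite {I : Ideal (𝓞 K) // Ideal.absNorm I = d} :=
    Ideal.finite_setOfPred_absNorm_eq d
  choose ψ hψ using key
  have hnorm : ∀ a h, Ideal.absNorm (RingHom.ker (ψ a h)) = d := by
    intro a h
    rw [Ideal.absNorm_apply, Submodule.cardQuot_apply]
    have := Nat.card_congr (RingHom.quotientKerEquivOfSurjective (ZMod.ringHom_surjective (ψ a h))).toEquiv
    rw [Nat.card_zmod] at this
    exact this
  rw [← Fintype.card_coe, ← Nat.card_eq_fintype_card]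
  refine Nat.card_le_card_of_injective
    (fun a => ⟨RingHom.ker (ψ a.1 (Finset.mem_filter.1 a.2).2), hnorm _ _⟩) ?_
  rintro ⟨a, ha⟩ ⟨b, hb⟩ hab
  simp only [Subtype.mk.injEq] at hab
  have ha' := Finset.mem_filter.1 ha
  have hb' := Finset.mem_filter.1 hb
  have h1 : η - ((M' * a : ℤ) : 𝓞 K) ∈ RingHom.ker (ψ a ha'.2) := by
    rw [RingHom.mem_ker, map_sub, hψ, map_intCast]; simp
  rw [hab, RingHom.mem_ker, map_sub, hψ, map_intCast] at h1
  push_cast at h1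
  rw [← mul_sub, hun.2.mul_right_eq_zero, sub_eq_zero, ZMod.natCast_eq_natCast_iff'] at h1
  rw [Nat.mod_eq_of_lt (by simpa using hb'.1), Nat.mod_eq_of_lt (by simpa using ha'.1)] at h1
  simp [h1]

theorem nf_ideal_count (K : Type) [Field K] [NumberField K] :
    ∃ C : ℝ, 0 < C ∧ ∀ n : ℕ, (∑ d ∈ Finset.Icc 1 n,
      (Nat.card {I : Ideal (𝓞 K) // Ideal.absNorm I = d} : ℝ)) ≤ C * n := by
  have ht := (NumberField.Ideal.tendsto_norm_le_div_atTop K).comp (tendsto_natCast_atTop_atTop (R := ℝ))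
  have hb := ht.bddAbove_range
  obtain ⟨C, hC⟩ := hb
  refine ⟨max C 1, by positivity, fun n => ?_⟩
  rcases Nat.eq_zero_or_pos n with rfl | hn
  · simp
  have h1 := hC ⟨n, rfl⟩
  simp only [Function.comp] at h1
  rw [div_le_iff₀ (by exact_mod_cast hn)] at h1
  have h2 : (∑ d ∈ Finset.Icc 1 n, (Nat.card {I : Ideal (𝓞 K) // Ideal.absNorm I = d} : ℝ))
      ≤ (Nat.card {I : Ideal (𝓞 K) // (Ideal.absNorm I : ℝ) ≤ n} : ℝ) := by
    rw [← Nat.cast_sum]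
    norm_cast
    have : Finite {I : Ideal (𝓞 K) // Ideal.absNorm I ≤ n} :=
      Ideal.finite_setOfPred_absNorm_le n
    have hf : ∀ d, Finite {I : Ideal (𝓞 K) // Ideal.absNorm I = d} := fun d =>
      Ideal.finite_setOfPred_absNorm_eq d
    rw [← Finset.sum_coe_sort, ← Nat.card_sigma]
    refine Nat.card_le_card_of_injective
      (fun x => ⟨x.2.1, by rw [x.2.2]; exact (Finset.mem_Icc.1 x.1.2).2⟩) ?_
    rintro ⟨⟨d, hd⟩, I, hI⟩ ⟨⟨e, he⟩, I', hI'⟩ h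
    simp only [Subtype.mk.injEq] at h
    subst h
    simp only at hI hI'
    subst hI
    subst hI'
    rfl
  refine h2.trans (h1.trans ?_)
  gcongr
  exact le_max_left _ _

end NF

theorem abel_log (h : ℕ → ℝ) (C : ℝ) (hC : 0 < C)
    (hh : ∀ n : ℕ, ∑ d ∈ Finset.Icc 1 n, h d ≤ C * n) :
    ∃ C' : ℝ, 0 < C' ∧ ∀ Q : ℕ, 2 ≤ Q → ∑ d ∈ Finset.Icc 1 Q, h d / d ≤ C' * Real.log Q := by
  have key : ∀ Q : ℕ, ∑ d ∈ Finset.Icc 1 Q, h d / d ≤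
      (∑ d ∈ Finset.Icc 1 Q, h d) / (Q + 1) + C * ∑ d ∈ Finset.range Q, ((d : ℝ) + 1)⁻¹ := by
    intro Q
    induction Q with
    | zero => simp
    | succ n ih =>
      rw [Finset.sum_Icc_succ_top (by omega), Finset.sum_range_succ]
      have h1 := hh (n + 1)
      rw [Finset.sum_Icc_succ_top (by omega)] at h1 ⊢
      set S := ∑ d ∈ Finset.Icc 1 n, h d
      push_cast at h1 ⊢
      have hn : (0 : ℝ) < n + 1 := by positivity
      have e : S / (n + 1 : ℝ) + h (n + 1) / (n + 1) = 
        (S + h (n+1)) / (n + 1 + 1) + (S + h (n+1)) / ((n+1) * (n + 1 + 1)) := by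
        field_simp
      have e2 : (S + h (n+1)) / ((n+1) * (n + 1 + 1)) ≤ C * ((n : ℝ) + 1)⁻¹ := by
        rw [div_le_iff₀ (by positivity)]
        refine h1.trans ?_
        have : C * ((n:ℝ) + 1)⁻¹ * ((n+1) * (n + 1 + 1)) = C * (n + 1 + 1) := by
          field_simp
        rw [this]
        nlinarith
      linarith
  refine ⟨C * (1 + 2 / Real.log 2), by positivity, fun Q hQ => (key Q).trans ?_⟩
  have hl2 : 0 < Real.log 2 := Real.log_pos (by norm_num)
  have hlQ : Real.log 2 ≤ Real.log Q := Real.log_le_log (by norm_num) (by exact_mod_cast hQ)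
  have h1 : (∑ d ∈ Finset.Icc 1 Q, h d) / (Q + 1) ≤ C := by
    rw [div_le_iff₀ (by positivity)]
    have := hh Q
    nlinarith
  have h2 : ∑ d ∈ Finset.range Q, ((d : ℝ) + 1)⁻¹ ≤ 1 + Real.log Q := by
    have := harmonic_le_one_add_log Q
    simpa [harmonic] using this
  have h3 : 2 ≤ 2 / Real.log 2 * Real.log Q := by
    rw [div_mul_eq_mul_div, le_div_iff₀ hl2]; linarith
  nlinarith

section SRsec
open Polynomial NumberField
open scoped Classical in
noncomputable def cntR (R : ℕ → ℕ → Prop) (d : ℕ) : ℕ := ((Finset.range d).filter (R d)).card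

noncomputable def SR (R : ℕ → ℕ → Prop) (Q : ℕ) : ℝ :=
  ∑ d ∈ (Finset.Icc 1 Q).filter Squarefree, (cntR R d : ℝ) / d

theorem SR_nonneg (R : ℕ → ℕ → Prop) (Q : ℕ) : 0 ≤ SR R Q :=
  Finset.sum_nonneg fun _ _ => by positivity

theorem cntR_le (R : ℕ → ℕ → Prop) (d : ℕ) : cntR R d ≤ d := by
  classical
  exact (Finset.card_filter_le _ _).trans (by simp)

theorem cntR_mono {R R' : ℕ → ℕ → Prop} {d : ℕ} (h : ∀ a, R d a → R' d a) :
    cntR R d ≤ cntR R' d := by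
  classical
  exact Finset.card_le_card (Finset.monotone_filter_right _ fun a _ ha => h a ha)

theorem SR_mono {R R' : ℕ → ℕ → Prop} (h : ∀ d a, R d a → R' d a) (Q : ℕ) :
    SR R Q ≤ SR R' Q := by
  refine Finset.sum_le_sum fun d _ => ?_
  have := cntR_mono (h d)
  gcongr

theorem cntR_mul {R R1 R2 : ℕ → ℕ → Prop} {d : ℕ} (hd : Squarefree d)
    (h : ∀ a, R d a → ∃ d1 d2, d1 * d2 = d ∧ R1 d1 (a % d1) ∧ R2 d2 (a % d2)) :
    cntR R d ≤ ∑ x ∈ d.divisorsAntidiagonal, cntR R1 x.1 * cntR R2 x.2 := by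
  classical
  have hd0 : d ≠ 0 := hd.ne_zero
  simp only [cntR]
  simp_rw [← Finset.card_product]
  rw [← Finset.card_sigma]
  choose! d1 d2 h12 hR1 hR2 using h
  refine Finset.card_le_card_of_injOn
    (fun a => (⟨(d1 a, d2 a), (a % d1 a, a % d2 a)⟩ : (_ : ℕ × ℕ) × (ℕ × ℕ))) ?_ ?_
  · intro a ha
    have ha := Finset.mem_filter.1 (Finset.mem_coe.1 ha)
    have e := h12 a ha.2
    have p1 : 0 < d1 a := Nat.pos_of_ne_zero fun h0 => hd0 (by rw [← e, h0, zero_mul])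
    have p2 : 0 < d2 a := Nat.pos_of_ne_zero fun h0 => hd0 (by rw [← e, h0, mul_zero])
    simp [e, hd0, hR1 a ha.2, hR2 a ha.2, Nat.mod_lt, p1, p2]
  · intro a ha b hb hab
    have ha := Finset.mem_filter.1 (Finset.mem_coe.1 ha)
    have hb := Finset.mem_filter.1 (Finset.mem_coe.1 hb)
    simp only [Sigma.mk.injEq, Prod.mk.injEq, heq_eq_eq] at hab
    obtain ⟨⟨e1, e2⟩, e3, e4⟩ := hab
    have hc : (d1 a).Coprime (d2 a) := by
      apply Nat.coprime_of_squarefree_mul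
      rw [h12 a ha.2]; exact hd
    rw [← e1] at e3
    rw [← e2] at e4
    have := (Nat.modEq_and_modEq_iff_modEq_mul hc).1 ⟨e3, e4⟩
    rw [h12 a ha.2] at this
    exact this.eq_of_lt_of_lt (by simpa using ha.1) (by simpa using hb.1)

theorem SR_mul {R R1 R2 : ℕ → ℕ → Prop}
    (h : ∀ d, Squarefree d → ∀ a, R d a → ∃ d1 d2, d1 * d2 = d ∧ R1 d1 (a % d1) ∧ R2 d2 (a % d2))
    (Q : ℕ) : SR R Q ≤ SR R1 Q * SR R2 Q := by
  classical
  have step : SR R Q ≤ ∑ d ∈ (Finset.Icc 1 Q).filter Squarefree,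
      ∑ x ∈ d.divisorsAntidiagonal, ((cntR R1 x.1 : ℝ) / x.1) * ((cntR R2 x.2 : ℝ) / x.2) := by
    refine Finset.sum_le_sum fun d hd => ?_
    have hd := Finset.mem_filter.1 hd
    have h1 := cntR_mul hd.2 (h d hd.2)
    calc (cntR R d : ℝ) / d ≤ (∑ x ∈ d.divisorsAntidiagonal, cntR R1 x.1 * cntR R2 x.2 : ℕ) / d := by
          gcongr
      _ = _ := by
        push_cast
        rw [Finset.sum_div]
        refine Finset.sum_congr rfl fun x hx => ?_
        rw [← (Nat.mem_divisorsAntidiagonal.1 hx).1]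
        push_cast
        rw [div_mul_div_comm]
  refine step.trans ?_
  rw [SR, SR, Finset.sum_mul_sum, ← Finset.sum_product']
  refine le_trans ?_ (Finset.sum_fiberwise_le_sum_of_sum_fiber_nonneg
    (t := (Finset.Icc 1 Q).filter Squarefree) (g := fun x : ℕ × ℕ => x.1 * x.2)
    (fun y _ => Finset.sum_nonneg fun _ _ => by positivity))
  refine Finset.sum_le_sum fun d hd => ?_
  refine Finset.sum_le_sum_of_subset_of_nonneg ?_ fun _ _ _ => by positivity
  intro x hx
  have hd := Finset.mem_filter.1 hd
  have hx := Nat.mem_divisorsAntidiagonal.1 hx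
  have hdQ := Finset.mem_Icc.1 hd.1
  have d1 : x.1 ∣ d := ⟨x.2, hx.1.symm⟩
  have d2 : x.2 ∣ d := ⟨x.1, by rw [mul_comm]; exact hx.1.symm⟩
  simp only [Finset.mem_filter, Finset.mem_product, Finset.mem_Icc]
  exact ⟨⟨⟨⟨Nat.pos_of_dvd_of_pos d1 hdQ.1, (Nat.le_of_dvd hdQ.1 d1).trans hdQ.2⟩,
    hd.2.squarefree_of_dvd d1⟩, ⟨Nat.pos_of_dvd_of_pos d2 hdQ.1,
    (Nat.le_of_dvd hdQ.1 d2).trans hdQ.2⟩, hd.2.squarefree_of_dvd d2⟩, hx.1⟩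

theorem dvd_eval_mod (G : ℤ[X]) (d a : ℕ) :
    (d : ℤ) ∣ G.eval ((a % d : ℕ) : ℤ) ↔ (d : ℤ) ∣ G.eval (a : ℤ) := by
  have h1 := Polynomial.sub_dvd_eval_sub (a : ℤ) ((a % d : ℕ) : ℤ) G
  have h2 : (d : ℤ) ∣ (a : ℤ) - ((a % d : ℕ) : ℤ) := by
    push_cast
    exact Int.dvd_self_sub_emod
  exact (dvd_iff_dvd_of_dvd_sub (h2.trans h1)).symm

theorem SR_const (M : ℕ) (hM : M ≠ 0) (Q : ℕ) : SR (fun d _ => d ∣ M) Q ≤ M := by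
  classical
  have : SR (fun d _ => d ∣ M) Q ≤ ∑ d ∈ M.divisors, (1 : ℝ) := by
    rw [SR, ← Finset.sum_filter_add_sum_filter_not _ (fun d => d ∣ M)]
    have h0 : ∑ d ∈ (Finset.filter Squarefree (Finset.Icc 1 Q)).filter (fun d => ¬ d ∣ M),
      ((cntR (fun d _ => d ∣ M) d : ℝ) / d) = 0 := by
      refine Finset.sum_eq_zero fun d hd => ?_
      have := (Finset.mem_filter.1 hd).2
      simp [cntR, this]
    rw [h0, add_zero]
    calc _ ≤ ∑ d ∈ (Finset.filter Squarefree (Finset.Icc 1 Q)).filter (fun d => d ∣ M), (1 : ℝ) := by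
          refine Finset.sum_le_sum fun d hd => ?_
          apply div_le_one_of_le₀ _ (by positivity)
          have : cntR (fun d _ => d ∣ M) d ≤ d := by
            exact cntR_le _ _
          exact_mod_cast this
      _ ≤ _ := by
          refine Finset.sum_le_sum_of_subset_of_nonneg ?_ fun _ _ _ => zero_le_one
          intro d hd
          exact Nat.mem_divisors.2 ⟨(Finset.mem_filter.1 hd).2, hM⟩
  refine this.trans ?_
  simp only [Finset.sum_const, nsmul_eq_mul, mul_one]
  exact_mod_cast Nat.card_divisors_le_self M

theorem SR_irr (G : ℤ[X]) (hG : G.IsPrimitive) (hirr : Irreducible (G.map (Int.castRingHom ℚ))) :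
    ∃ C : ℝ, 0 < C ∧ ∀ Q : ℕ, 2 ≤ Q → 
      SR (fun d a => (d : ℤ) ∣ G.eval (a : ℤ)) Q ≤ C * Real.log Q := by
  classical
  have : Fact (Irreducible (G.map (Int.castRingHom ℚ))) := ⟨hirr⟩
  let K := AdjoinRoot (G.map (Int.castRingHom ℚ))
  let _ : Field K := AdjoinRoot.instField
  have hcz : CharZero K := charZero_of_injective_algebraMap (algebraMap ℚ K).injective
  have hfin : Module.Finite ℚ K := (AdjoinRoot.powerBasis hirr.ne_zero).finite
  have hNF : NumberField K := { to_charZero := hcz, to_finiteDimensional := by convert hfin }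
  let θ : K := AdjoinRoot.root _
  have hmap : ∀ F : ℤ[X], aeval θ F = AdjoinRoot.mk (G.map (Int.castRingHom ℚ)) (F.map (Int.castRingHom ℚ)) := by
    intro F
    rw [← AdjoinRoot.aeval_eq]
    exact (aeval_map_algebraMap ℚ θ F).symm
  have hker : ∀ F : ℤ[X], aeval θ F = 0 → G ∣ F := by
    intro F hF
    rw [hmap, AdjoinRoot.mk_eq_zero] at hF
    exact (IsPrimitive.Int.dvd_iff_map_cast_dvd_map_cast G F hG).2 hF
  have hgen : ∀ x : K, ∃ b : ℤ, b ≠ 0 ∧ ∃ F : ℤ[X], (b : K) * x = aeval θ F := by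
    intro x
    obtain ⟨p, rfl⟩ := AdjoinRoot.mk_surjective x
    obtain ⟨b, hb, hbp⟩ := IsLocalization.integerNormalization_spec (nonZeroDivisors ℤ) p
    refine ⟨b, nonZeroDivisors.ne_zero hb, IsLocalization.integerNormalization (nonZeroDivisors ℤ) p, ?_⟩
    rw [hmap]
    erw [hbp]
    rw [zsmul_eq_mul, map_mul, map_intCast]
  obtain ⟨M, hM0, hM⟩ := nf_roots_le K θ G hker hgen
  obtain ⟨C, hC, hcount⟩ := nf_ideal_count K
  obtain ⟨C', hC', hlog⟩ := abel_log _ C hC hcount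
  refine ⟨M * C', by positivity, fun Q hQ => ?_⟩
  have h1 := SR_mul (R := fun d a => (d : ℤ) ∣ G.eval (a : ℤ)) (R1 := fun d a => d ∣ M)
    (R2 := fun d a => d.Coprime M ∧ (d : ℤ) ∣ G.eval (a : ℤ)) (by
      intro d hd a ha
      have hg : d.gcd M * (d / d.gcd M) = d := Nat.mul_div_cancel' (Nat.gcd_dvd_left d M)
      have hpos : 0 < d.gcd M := Nat.gcd_pos_of_pos_left _ (Nat.pos_of_ne_zero hd.ne_zero)
      have hc : (d.gcd M).Coprime (d / d.gcd M) := by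
        apply Nat.coprime_of_squarefree_mul
        rw [hg]; exact hd
      refine ⟨d.gcd M, d / d.gcd M, hg, Nat.gcd_dvd_right d M, ?_, ?_⟩
      · have k1 := Nat.gcd_dvd_left (d / d.gcd M) M
        have k2 := Nat.gcd_dvd_right (d / d.gcd M) M
        have k3 : (d / d.gcd M) ∣ d := ⟨d.gcd M, by rw [mul_comm]; exact hg.symm⟩
        exact Nat.eq_one_of_dvd_coprimes hc (Nat.dvd_gcd (k1.trans k3) k2) k1
      · rw [dvd_eval_mod]
        have k3 : (d / d.gcd M) ∣ d := ⟨d.gcd M, by rw [mul_comm]; exact hg.symm⟩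
        exact (Int.natCast_dvd_natCast.2 k3).trans ha) Q
  refine h1.trans ?_
  rw [mul_assoc]
  refine mul_le_mul (SR_const M hM0 Q) ?_ (SR_nonneg _ _) (by positivity)
  refine le_trans ?_ (hlog Q hQ)
  rw [SR]
  refine (Finset.sum_le_sum_of_subset_of_nonneg (Finset.filter_subset _ _)
    fun _ _ _ => by positivity).trans ?_
  refine Finset.sum_le_sum fun d hd => ?_
  have hd := Finset.mem_Icc.1 hd
  gcongr
  by_cases hc : d.Coprime M
  · refine le_trans (le_of_eq ?_) (hM d hd.1 hc)
    unfold cntR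
    congr 1
    ext a
    simp only [Finset.mem_filter]
    tauto
  · simp [cntR, hc]

theorem SR_poly_mul (A B : ℤ[X]) (Q : ℕ) :
    SR (fun d a => (d : ℤ) ∣ (A * B).eval (a : ℤ)) Q ≤
      SR (fun d a => (d : ℤ) ∣ A.eval (a : ℤ)) Q * SR (fun d a => (d : ℤ) ∣ B.eval (a : ℤ)) Q := by
  refine SR_mul ?_ Q
  intro d hd a ha
  simp only [dvd_eval_mod]
  rw [eval_mul] at ha
  set g := Int.gcd d (A.eval (a : ℤ)) with hgdef
  have h1 : (g : ℤ) ∣ d := Int.gcd_dvd_left _ _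
  have h2 : (g : ℤ) ∣ A.eval (a : ℤ) := Int.gcd_dvd_right _ _
  have h1' : g ∣ d := by exact_mod_cast h1
  refine ⟨g, d / g, Nat.mul_div_cancel' h1', h2, ?_⟩
  have h3 := Int.dvd_gcd_mul_iff_dvd_mul.2 ha
  rw [← hgdef] at h3
  have hg0 : (g : ℤ) ≠ 0 := by
    intro h0
    have : g = 0 := by exact_mod_cast h0
    rw [this, zero_dvd_iff] at h1'
    exact hd.ne_zero h1'
  have h4 : (d : ℤ) = g * ((d / g : ℕ) : ℤ) := by exact_mod_cast (Nat.mul_div_cancel' h1').symm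
  rw [h4] at h3
  exact (mul_dvd_mul_iff_left hg0).1 h3

theorem SR_poly_prod {ι : Type*} (S : Finset ι) (G : ι → ℤ[X]) (Q : ℕ) :
    SR (fun d a => (d : ℤ) ∣ (∏ i ∈ S, G i).eval (a : ℤ)) Q ≤
      ∏ i ∈ S, SR (fun d a => (d : ℤ) ∣ (G i).eval (a : ℤ)) Q := by
  classical
  induction S using Finset.induction_on with
  | empty =>
    simp only [Finset.prod_empty, eval_one]
    refine le_trans (SR_mono (R' := fun d _ => d ∣ 1) ?_ Q) (by exact_mod_cast SR_const 1 one_ne_zero Q)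
    intro d a h
    exact_mod_cast h
  | insert i S hi ih =>
    rw [Finset.prod_insert hi, Finset.prod_insert hi]
    refine (SR_poly_mul _ _ Q).trans ?_
    exact mul_le_mul_of_nonneg_left ih (SR_nonneg _ _)

theorem exists_prim (q : ℚ[X]) (hq : q ≠ 0) :
    ∃ G : ℤ[X], G.IsPrimitive ∧ Associated (G.map (Int.castRingHom ℚ)) q := by
  obtain ⟨b, hb, hbp⟩ := IsLocalization.integerNormalization_spec (nonZeroDivisors ℤ) q
  set A := IsLocalization.integerNormalization (nonZeroDivisors ℤ) q
  have hb0 : b ≠ 0 := nonZeroDivisors.ne_zero hb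
  have hbp' : A.map (Int.castRingHom ℚ) = C (b : ℚ) * q := by
    have : A.map (Int.castRingHom ℚ) = b • q := hbp
    rw [this, zsmul_eq_mul]; simp
  have hA0 : A ≠ 0 := by
    intro h
    rw [h, Polynomial.map_zero] at hbp'
    have := hbp'.symm
    simp [hb0, hq] at this
  refine ⟨A.primPart, A.isPrimitive_primPart, ?_⟩
  have h1 := A.eq_C_content_mul_primPart
  have h2 : A.map (Int.castRingHom ℚ) = C (A.content : ℚ) * A.primPart.map (Int.castRingHom ℚ) := by
    conv_lhs => rw [h1]
    simp
  have hc0 : A.content ≠ 0 := fun h => hA0 (Polynomial.content_eq_zero_iff.1 h)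
  have u1 : IsUnit (C (A.content : ℚ)) := Polynomial.isUnit_C.2 (by simpa using hc0)
  have u2 : IsUnit (C (b : ℚ)) := Polynomial.isUnit_C.2 (by simpa using hb0)
  have e : C (A.content : ℚ) * A.primPart.map (Int.castRingHom ℚ) = C (b : ℚ) * q := by
    rw [← h2, hbp']
  have a1 := associated_unit_mul_left (A.primPart.map (Int.castRingHom ℚ)) _ u1
  have a2 := associated_unit_mul_left q _ u2
  rw [e] at a1
  exact a1.symm.trans a2

theorem clear_dvd (P H : ℤ[X]) (h : P.map (Int.castRingHom ℚ) ∣ H.map (Int.castRingHom ℚ)) :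
    ∃ b : ℤ, b ≠ 0 ∧ P ∣ C b * H := by
  obtain ⟨R, hR⟩ := h
  obtain ⟨b, hb, hbp⟩ := IsLocalization.integerNormalization_spec (nonZeroDivisors ℤ) R
  set A := IsLocalization.integerNormalization (nonZeroDivisors ℤ) R
  have hb0 : b ≠ 0 := nonZeroDivisors.ne_zero hb
  have hbp' : A.map (Int.castRingHom ℚ) = C (b : ℚ) * R := by
    have : A.map (Int.castRingHom ℚ) = b • R := hbp
    rw [this, zsmul_eq_mul]; simp
  refine ⟨b, hb0, A, ?_⟩
  apply Polynomial.map_injective (Int.castRingHom ℚ) Int.cast_injective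
  rw [Polynomial.map_mul, Polynomial.map_mul, hbp', hR]
  simp
  ring

theorem SR_main (P : ℤ[X]) (hsep : (P.map (Int.castRingHom ℚ)).Separable) :
    ∃ C : ℝ, 0 < C ∧ ∀ Q : ℕ, 2 ≤ Q →
      SR (fun d a => (d : ℤ) ∣ P.eval (a : ℤ)) Q ≤ C * Real.log Q ^ (numIrredFactors P) := by
  classical
  set f := P.map (Int.castRingHom ℚ) with hf
  have hf0 : f ≠ 0 := hsep.ne_zero
  set S := (UniqueFactorizationMonoid.normalizedFactors f).toFinset with hS
  have hmem : ∀ q, q ∈ S ↔ q.Monic ∧ Irreducible q ∧ q ∣ f := by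
    intro q
    rw [hS, Multiset.mem_toFinset, UniqueFactorizationMonoid.mem_normalizedFactors_iff' hf0]
    constructor
    · rintro ⟨h1, h2, h3⟩
      exact ⟨by rw [← h2]; exact Polynomial.monic_normalize h1.ne_zero, h1, h3⟩
    · rintro ⟨h1, h2, h3⟩
      exact ⟨h2, h1.normalize_eq_self, h3⟩
  have hJ : numIrredFactors P = S.card := by
    rw [numIrredFactors, ← Fintype.card_coe, ← Nat.card_eq_fintype_card]
    exact Nat.card_congr (Equiv.subtypeEquivRight fun q => (hmem q).symm)
  have hprod : f ∣ ∏ q ∈ S, q := by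
    have hnd := (UniqueFactorizationMonoid.squarefree_iff_nodup_normalizedFactors hf0).1
      hsep.squarefree
    have : ∏ q ∈ S, q = (UniqueFactorizationMonoid.normalizedFactors f).prod := by
      rw [hS, Finset.prod_eq_multiset_prod, Multiset.toFinset_val, Multiset.dedup_eq_self.2 hnd, Multiset.map_id']
    rw [this]
    exact (UniqueFactorizationMonoid.prod_normalizedFactors hf0).symm.dvd
  have hG : ∀ q : ℚ[X], ∃ G : ℤ[X], q ∈ S → G.IsPrimitive ∧ Associated (G.map (Int.castRingHom ℚ)) q := by
    intro q
    by_cases hq : q ∈ S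
    · obtain ⟨G, h⟩ := exists_prim q ((hmem q).1 hq).2.1.ne_zero
      exact ⟨G, fun _ => h⟩
    · exact ⟨0, fun h => absurd h hq⟩
  choose G hG using hG
  have hdvd : f ∣ (∏ q ∈ S, G q).map (Int.castRingHom ℚ) := by
    rw [Polynomial.map_prod]
    exact hprod.trans (Finset.prod_dvd_prod_of_dvd _ _ fun q hq => (hG q hq).2.symm.dvd)
  obtain ⟨b, hb0, hb⟩ := clear_dvd P _ hdvd
  have hirr : ∀ q : ℚ[X], ∃ c : ℝ, 0 < c ∧ (q ∈ S → ∀ Q : ℕ, 2 ≤ Q →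
      SR (fun d a => (d : ℤ) ∣ (G q).eval (a : ℤ)) Q ≤ c * Real.log Q) := by
    intro q
    by_cases hq : q ∈ S
    · obtain ⟨c, hc, h⟩ := SR_irr (G q) (hG q hq).1
        ((hG q hq).2.symm.irreducible ((hmem q).1 hq).2.1)
      exact ⟨c, hc, fun _ => h⟩
    · exact ⟨1, one_pos, fun h => absurd h hq⟩
  choose c hc hcS using hirr
  refine ⟨b.natAbs * ∏ q ∈ S, c q, mul_pos (by simpa using hb0) (Finset.prod_pos fun q _ => hc q), fun Q hQ => ?_⟩
  calc SR (fun d a => (d : ℤ) ∣ P.eval (a : ℤ)) Q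
      ≤ SR (fun d a => (d : ℤ) ∣ (C b * ∏ q ∈ S, G q).eval (a : ℤ)) Q :=
        SR_mono (fun d a h => h.trans (Polynomial.eval_dvd hb)) Q
    _ ≤ _ := SR_poly_mul _ _ Q
    _ ≤ b.natAbs * ∏ q ∈ S, (c q * Real.log Q) := by
        refine mul_le_mul ?_ ?_ (SR_nonneg _ _) (by positivity)
        · refine le_trans (SR_mono ?_ Q) (SR_const b.natAbs (by simpa using hb0) Q)
          intro d a h
          rw [eval_C] at h
          exact Int.natCast_dvd.1 h
        · exact (SR_poly_prod S G Q).trans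
            (Finset.prod_le_prod (fun _ _ => SR_nonneg _ _) fun q hq => hcS q hq Q hQ)
    _ = _ := by
        rw [Finset.prod_mul_distrib, Finset.prod_const, hJ, mul_assoc]
end SRsec

section Count
open Polynomial

/-- divisibility relation of a polynomial -/
def RP (P : ℤ[X]) : ℕ → ℕ → Prop := fun d a => (d : ℤ) ∣ P.eval (a : ℤ)

theorem cnt_block (P : ℤ[X]) (d k : ℕ) :
    ((Finset.Icc 1 (d * k)).filter (fun a : ℕ => (d : ℤ) ∣ P.eval (a : ℤ))).card =
      k * cntR (RP P) d := by
  classical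
  have hper : Function.Periodic (fun a : ℕ => (d : ℤ) ∣ P.eval (a : ℤ)) d := by
    intro a
    have h1 := dvd_eval_mod P d (a + d)
    have h2 := dvd_eval_mod P d a
    rw [Nat.add_mod_right] at h1
    exact propext (h1.symm.trans h2)
  have hI : ∀ x, Finset.Icc 1 x = Finset.Ico 1 (1 + x) := by
    intro x; ext a; simp [Finset.mem_Icc, Finset.mem_Ico]; omega
  induction k with
  | zero => simp
  | succ k ih =>
    rw [hI] at ih ⊢
    have h1 : Finset.Ico 1 (1 + d * (k+1)) = Finset.Ico 1 (1 + d * k) ∪ Finset.Ico (1 + d * k) (1 + d * k + d) := by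
      rw [Finset.Ico_union_Ico_eq_Ico (by omega) (by omega)]
      congr 1
      ring
    rw [h1, Finset.filter_union, Finset.card_union_of_disjoint, ih,
      Nat.filter_Ico_card_eq_of_periodic _ _ _ hper, Nat.count_eq_card_filter_range, add_mul, one_mul]
    · congr 1
      unfold cntR RP
      congr
    · exact Finset.disjoint_filter_filter (Finset.Ico_disjoint_Ico_consecutive _ _ _)

theorem cnt_approx (P : ℤ[X]) (d : ℕ) (hd : 0 < d) (y : ℝ) (hy : 0 ≤ y) :
    |(((Finset.Icc 1 ⌊y⌋₊).filter (fun a : ℕ => (d : ℤ) ∣ P.eval (a : ℤ))).card : ℝ)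
      - y / d * cntR (RP P) d| ≤ cntR (RP P) d := by
  have hd' : (0 : ℝ) < d := by exact_mod_cast hd
  set k := ⌊y / d⌋₊ with hk
  have k1 : (k : ℝ) ≤ y / d := Nat.floor_le (by positivity)
  have k2 : y / d < k + 1 := Nat.lt_floor_add_one _
  have h1 : d * k ≤ ⌊y⌋₊ := by
    apply Nat.le_floor
    push_cast
    rw [le_div_iff₀ hd'] at k1
    linarith
  have h2 : ⌊y⌋₊ ≤ d * (k + 1) := by
    have : ⌊y⌋₊ < d * (k + 1) := by
      rw [Nat.floor_lt hy]
      push_cast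
      rw [div_lt_iff₀ hd'] at k2
      linarith
    exact this.le
  have c1 := Finset.card_le_card (Finset.filter_subset_filter
    (fun a : ℕ => (d : ℤ) ∣ P.eval (a : ℤ)) (Finset.Icc_subset_Icc_right (a := 1) h1))
  have c2 := Finset.card_le_card (Finset.filter_subset_filter
    (fun a : ℕ => (d : ℤ) ∣ P.eval (a : ℤ)) (Finset.Icc_subset_Icc_right (a := 1) h2))
  rw [cnt_block] at c1 c2
  set g := ((Finset.Icc 1 ⌊y⌋₊).filter (fun a : ℕ => (d : ℤ) ∣ P.eval (a : ℤ))).card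
  have c1' : (k : ℝ) * cntR (RP P) d ≤ g := by exact_mod_cast c1
  have c2' : (g : ℝ) ≤ ((k : ℝ) + 1) * cntR (RP P) d := by exact_mod_cast c2
  have hf : (0 : ℝ) ≤ cntR (RP P) d := by positivity
  rw [abs_le]
  constructor <;> nlinarith

theorem moeb_gcd (q : ℕ) (hq : 0 < q) (n : ℤ) :
    (if Int.gcd n q = 1 then (1 : ℤ) else 0) =
      ∑ d ∈ q.divisors, if (d : ℤ) ∣ n then ArithmeticFunction.moebius d else 0 := by
  rw [← Finset.sum_filter]
  have : q.divisors.filter (fun d : ℕ => (d : ℤ) ∣ n) = (Int.gcd n q).divisors := by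
    have hg : Int.gcd n q ≠ 0 := by
      intro h
      rw [Int.gcd_eq_zero_iff] at h
      have := h.2
      omega
    ext d
    simp only [Finset.mem_filter, Nat.mem_divisors]
    rw [← Int.natCast_dvd_natCast (n := Int.gcd n q), Int.dvd_coe_gcd_iff, Int.natCast_dvd_natCast]
    constructor
    · rintro ⟨⟨h1, h2⟩, h3⟩
      exact ⟨⟨h3, h1⟩, hg⟩
    · rintro ⟨⟨h1, h2⟩, h3⟩
      exact ⟨⟨h2, hq.ne'⟩, h1⟩
  rw [this]
  have h2 := congrArg (fun F : ArithmeticFunction ℤ => F (Int.gcd n q))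
    ArithmeticFunction.moebius_mul_coe_zeta
  simp only [ArithmeticFunction.coe_mul_zeta_apply, ArithmeticFunction.one_apply] at h2
  exact h2.symm

/-- count of admissible numerators up to x -/
def Aq (P : ℤ[X]) (q x : ℕ) : ℕ :=
  ((Finset.Icc 1 x).filter (fun a : ℕ => Int.gcd (P.eval (a : ℤ)) (q : ℤ) = 1)).card

theorem Aq_eq (P : ℤ[X]) (q x : ℕ) (hq : 0 < q) :
    (Aq P q x : ℝ) = ∑ d ∈ q.divisors, (ArithmeticFunction.moebius d : ℝ) *
      (((Finset.Icc 1 x).filter (fun a : ℕ => (d : ℤ) ∣ P.eval (a : ℤ))).card : ℝ) := by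
  have h : (Aq P q x : ℤ) = ∑ d ∈ q.divisors, (ArithmeticFunction.moebius d : ℤ) *
      (((Finset.Icc 1 x).filter (fun a : ℕ => (d : ℤ) ∣ P.eval (a : ℤ))).card : ℤ) := by
    rw [Aq, Finset.card_filter]
    push_cast
    simp_rw [moeb_gcd q hq]
    rw [Finset.sum_comm]
    refine Finset.sum_congr rfl fun d _ => ?_
    rw [Finset.card_filter]
    push_cast
    rw [Finset.mul_sum]
    refine Finset.sum_congr rfl fun a _ => ?_
    split_ifs <;> simp
  exact_mod_cast congrArg (fun z : ℤ => (z : ℝ)) h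

theorem Aq_diff (P : ℤ[X]) (q : ℕ) (hq : 0 < q) (α : ℝ) (hα : 0 ≤ α) :
    |(Aq P q ⌊α * q⌋₊ : ℝ) - α * Aq P q q| ≤
      ∑ d ∈ q.divisors, |(ArithmeticFunction.moebius d : ℝ)| * cntR (RP P) d := by
  rw [Aq_eq P q _ hq, Aq_eq P q q hq, Finset.mul_sum, ← Finset.sum_sub_distrib]
  refine (Finset.abs_sum_le_sum_abs _ _).trans (Finset.sum_le_sum fun d hd => ?_)
  have hdq := (Nat.mem_divisors.1 hd).1
  have hd0 : 0 < d := Nat.pos_of_dvd_of_pos hdq hq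
  have hd' : (0 : ℝ) < d := by exact_mod_cast hd0
  obtain ⟨k, rfl⟩ := hdq
  have h1 := cnt_approx P d hd0 (α * (d * k : ℕ)) (by positivity)
  rw [cnt_block P d k]
  have e : α * ((d * k : ℕ) : ℝ) / d = α * k := by
    push_cast; field_simp
  rw [e] at h1
  rw [mul_left_comm, ← mul_sub, abs_mul]
  refine mul_le_mul_of_nonneg_left ?_ (abs_nonneg _)
  rw [Nat.cast_mul k]
  rwa [← mul_assoc α]

theorem sumE (P : ℤ[X]) (Q : ℕ) :
    ∑ q ∈ Finset.Icc 1 Q, ∑ d ∈ q.divisors, |(ArithmeticFunction.moebius d : ℝ)| * cntR (RP P) d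
      ≤ Q * SR (RP P) Q := by
  classical
  rw [Finset.sum_comm' (t' := Finset.Icc 1 Q) (s' := fun d => (Finset.Icc 1 Q).filter (fun q => d ∣ q))]
  · rw [SR, Finset.mul_sum, Finset.sum_filter]
    refine Finset.sum_le_sum fun d hd => ?_
    have hd := Finset.mem_Icc.1 hd
    rw [Finset.sum_const, nsmul_eq_mul]
    split_ifs with hs
    · have h1 : |(ArithmeticFunction.moebius d : ℝ)| = 1 := by
        exact_mod_cast congrArg (fun z : ℤ => (z : ℝ)) (ArithmeticFunction.abs_moebius_eq_one_of_squarefree hs)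
      rw [h1, one_mul]
      have h2 : ((Finset.Icc 1 Q).filter (fun q => d ∣ q)).card = Q / d :=
        Nat.Ioc_filter_dvd_card_eq_div Q d
      rw [h2, mul_div_assoc', mul_comm (Q : ℝ), mul_comm _ ((cntR (RP P) d : ℝ)), mul_div_assoc]
      gcongr
      exact Nat.cast_div_le
    · rw [ArithmeticFunction.moebius_eq_zero_of_not_squarefree hs]; simp
  · intro q d
    simp only [Finset.mem_Icc, Nat.mem_divisors, Finset.mem_filter]
    constructor
    · rintro ⟨⟨h1, h2⟩, h3, h4⟩
      exact ⟨⟨⟨h1, h2⟩, h3⟩, Nat.pos_of_dvd_of_pos h3 h1, (Nat.le_of_dvd h1 h3).trans h2⟩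
    · rintro ⟨⟨⟨h1, h2⟩, h3⟩, h4, h5⟩
      exact ⟨⟨h1, h2⟩, h3, by omega⟩

open scoped Classical in
theorem card_pairs (P : ℤ[X]) (Q : ℕ) (α : ℝ) (h0 : 0 ≤ α) (h1 : α ≤ 1) :
    ((fareyPairs P Q).filter (fun x => ((x.1 : ℝ) / (x.2 : ℝ)) ≤ α)).card =
      ∑ q ∈ Finset.Icc 1 Q, Aq P q ⌊α * q⌋₊ := by
  rw [Finset.card_eq_sum_card_fiberwise (f := fun x => x.2) (t := Finset.Icc 1 Q)]
  · refine Finset.sum_congr rfl fun q hq => ?_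
    have hq := Finset.mem_Icc.1 hq
    have hq' : (0 : ℝ) < q := by exact_mod_cast hq.1
    unfold Aq
    refine Finset.card_bij' (fun x _ => x.1) (fun a _ => (a, q)) ?_ ?_ ?_ ?_
    · intro x hx
      simp only [fareyPairs, Finset.mem_filter, Finset.mem_product, Finset.mem_Icc] at hx ⊢
      obtain ⟨⟨⟨⟨⟨h2, h3⟩, h4⟩, h5, h6⟩, h7⟩, rfl⟩ := hx
      refine ⟨⟨h2, Nat.le_floor ?_⟩, h6⟩
      rwa [div_le_iff₀ hq'] at h7
    · intro a ha
      simp only [fareyPairs, Finset.mem_filter, Finset.mem_product, Finset.mem_Icc] at ha ⊢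
      obtain ⟨⟨h2, h3⟩, h4⟩ := ha
      have h5 : (a : ℝ) ≤ α * q := (Nat.le_floor_iff (by positivity)).1 h3
      have h6 : a ≤ q := by
        have : (a : ℝ) ≤ q := h5.trans (by nlinarith)
        exact_mod_cast this
      refine ⟨⟨⟨⟨⟨h2, h6.trans hq.2⟩, hq⟩, h6, h4⟩, ?_⟩, trivial⟩
      rwa [div_le_iff₀ hq']
    · intro x hx
      have := (Finset.mem_filter.1 hx).2
      ext
      · rfl
      · exact this.symm
    · intro a _
      rfl
  · intro x hx
    have := Finset.mem_coe.1 hx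
    simp only [fareyPairs, Finset.mem_filter, Finset.mem_product] at this
    exact this.1.1.2

theorem card_pairs_one (P : ℤ[X]) (Q : ℕ) :
    (fareyPairs P Q).card = ∑ q ∈ Finset.Icc 1 Q, Aq P q q := by
  classical
  have := card_pairs P Q 1 zero_le_one le_rfl
  simp only [one_mul, Nat.floor_natCast] at this
  rw [← this]
  congr 1
  symm
  apply Finset.filter_true_of_mem
  intro x hx
  simp only [fareyPairs, Finset.mem_filter] at hx
  apply div_le_one_of_le₀ _ (by positivity)
  exact_mod_cast hx.2.1

open scoped Classical in
theorem disc_upper (P : ℤ[X]) (Q : ℕ) (α : ℝ) (h0 : 0 ≤ α) (h1 : α ≤ 1) :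
    |(((fareyPairs P Q).filter (fun x => ((x.1 : ℝ) / (x.2 : ℝ)) ≤ α)).card : ℝ)
      - α * (fareyPairs P Q).card| ≤ Q * SR (RP P) Q := by
  rw [card_pairs P Q α h0 h1, card_pairs_one]
  push_cast
  rw [Finset.mul_sum, ← Finset.sum_sub_distrib]
  refine (Finset.abs_sum_le_sum_abs _ _).trans (le_trans ?_ (sumE P Q))
  refine Finset.sum_le_sum fun q hq => Aq_diff P q (Finset.mem_Icc.1 hq).1 α h0
end Count

section Lower
open Polynomial

theorem cntR_prime_le (P : ℤ[X]) (p : ℕ) (hp : p.Prime) (hlc : ¬ (p : ℤ) ∣ P.leadingCoeff) :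
    cntR (RP P) p ≤ P.natDegree := by
  classical
  have : Fact p.Prime := ⟨hp⟩
  set F := P.map (Int.castRingHom (ZMod p)) with hF
  have hF0 : F ≠ 0 := by
    intro h
    apply hlc
    have h1 : F.coeff P.natDegree = 0 := by rw [h]; simp
    rw [hF, coeff_map] at h1
    rw [← ZMod.intCast_zmod_eq_zero_iff_dvd]
    exact h1
  calc cntR (RP P) p ≤ F.roots.toFinset.card := by
        unfold cntR
        refine Finset.card_le_card_of_injOn (fun a : ℕ => (a : ZMod p)) ?_ ?_
        · intro a ha
          have ha := (Finset.mem_filter.1 (Finset.mem_coe.1 ha)).2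
          simp only [Finset.mem_coe, Multiset.mem_toFinset, mem_roots hF0, IsRoot.def]
          have : F.eval ((a : ℤ) : ZMod p) = ((P.eval (a : ℤ) : ℤ) : ZMod p) := by
            rw [hF, eval_intCast_map]; simp
          rw [Int.cast_natCast] at this
          rw [this, ZMod.intCast_zmod_eq_zero_iff_dvd]
          exact ha
        · intro a ha b hb hab
          have ha := (Finset.mem_filter.1 (Finset.mem_coe.1 ha)).1
          have hb := (Finset.mem_filter.1 (Finset.mem_coe.1 hb)).1
          simp only [ZMod.natCast_eq_natCast_iff'] at hab
          rwa [Nat.mod_eq_of_lt (by simpa using ha), Nat.mod_eq_of_lt (by simpa using hb)] at hab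
    _ ≤ Multiset.card F.roots := Multiset.toFinset_card_le _
    _ ≤ F.natDegree := card_roots' _
    _ ≤ P.natDegree := natDegree_map_le

theorem Aq_lower (P : ℤ[X]) (q : ℕ) (hq : 0 < q) :
    (q : ℝ) - ∑ p ∈ q.primeFactors, (q : ℝ) / p * cntR (RP P) p ≤ Aq P q q := by
  classical
  have h1 : Finset.Icc 1 q ⊆
      (Finset.Icc 1 q).filter (fun a : ℕ => Int.gcd (P.eval (a : ℤ)) (q : ℤ) = 1) ∪
      q.primeFactors.biUnion (fun p => (Finset.Icc 1 q).filter (fun a : ℕ => (p : ℤ) ∣ P.eval (a : ℤ))) := by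
    intro a ha
    rw [Finset.mem_union]
    by_cases hg : Int.gcd (P.eval (a : ℤ)) (q : ℤ) = 1
    · exact Or.inl (Finset.mem_filter.2 ⟨ha, hg⟩)
    · right
      obtain ⟨p, hp, hpd⟩ := Nat.exists_prime_and_dvd hg
      have hpd' : (p : ℤ) ∣ (Int.gcd (P.eval (a : ℤ)) (q : ℤ) : ℤ) := by exact_mod_cast hpd
      rw [Int.dvd_coe_gcd_iff] at hpd'
      rw [Finset.mem_biUnion]
      refine ⟨p, ?_, Finset.mem_filter.2 ⟨ha, hpd'.1⟩⟩
      rw [Nat.mem_primeFactors]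
      exact ⟨hp, by exact_mod_cast hpd'.2, hq.ne'⟩
  have h2 := (Finset.card_le_card h1).trans
    ((Finset.card_union_le _ _).trans (Nat.add_le_add_left Finset.card_biUnion_le _))
  rw [Nat.card_Icc, Nat.add_sub_cancel] at h2
  have h3 : ∑ p ∈ q.primeFactors, (((Finset.Icc 1 q).filter (fun a : ℕ => (p : ℤ) ∣ P.eval (a : ℤ))).card : ℝ)
      = ∑ p ∈ q.primeFactors, (q : ℝ) / p * cntR (RP P) p := by
    refine Finset.sum_congr rfl fun p hp => ?_
    have hp := Nat.mem_primeFactors.1 hp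
    have hp0 : (0 : ℝ) < p := by exact_mod_cast hp.1.pos
    obtain ⟨k, rfl⟩ := hp.2.1
    rw [cnt_block]
    push_cast
    field_simp
  have h4 : (q : ℝ) ≤ Aq P q q + ∑ p ∈ q.primeFactors, (((Finset.Icc 1 q).filter (fun a : ℕ => (p : ℤ) ∣ P.eval (a : ℤ))).card : ℝ) := by
    exact_mod_cast h2
  rw [h3] at h4
  linarith

theorem prime_sum (T W Q n : ℕ) (hT : T ≠ 0) (hTQ : T ≤ Q) (hW : W = T.factorial) (hn : 1 + W * n ≤ Q) :
    ∑ j ∈ Finset.Icc 1 n, ∑ p ∈ (1 + W * j).primeFactors, (1 : ℝ) / p ≤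
      n / T + (1 + Real.log Q) := by
  classical
  have hW0 : 0 < W := hW ▸ Nat.factorial_pos T
  rw [Finset.sum_comm' (t' := (Finset.Ioc T Q).filter Nat.Prime)
    (s' := fun p => (Finset.Icc 1 n).filter (fun j => p ∣ 1 + W * j))]
  · calc _ ≤ ∑ p ∈ (Finset.Ioc T Q).filter Nat.Prime, (((n : ℝ) / p + 1) * (1 / p)) := by
          refine Finset.sum_le_sum fun p hp => ?_
          have hp := Finset.mem_filter.1 hp
          have hpI := Finset.mem_Ioc.1 hp.1
          rw [Finset.sum_const, nsmul_eq_mul]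
          refine mul_le_mul_of_nonneg_right ?_ (by positivity)
          have h1 := cnt_approx (C (W : ℤ) * X + C 1) p hp.2.pos n (by positivity)
          have hWz : (W : ℤ) ≠ 0 := by exact_mod_cast hW0.ne'
          have h2 := cntR_prime_le (C (W : ℤ) * X + C 1) p hp.2 (by
            rw [leadingCoeff_linear hWz, Int.natCast_dvd_natCast, hW, hp.2.dvd_factorial]
            omega)
          rw [natDegree_linear hWz] at h2
          have h2' : (cntR (RP (C (W : ℤ) * X + C 1)) p : ℝ) ≤ 1 := by exact_mod_cast h2
          rw [Nat.floor_natCast] at h1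
          have h3 : (Finset.Icc 1 n).filter (fun a : ℕ => (p : ℤ) ∣ (C (W : ℤ) * X + C 1).eval (a : ℤ)) =
            (Finset.Icc 1 n).filter (fun j => p ∣ 1 + W * j) := by
            refine Finset.filter_congr fun a _ => ?_
            simp only [eval_add, eval_mul, eval_C, eval_X]
            rw [← Int.natCast_dvd_natCast]
            push_cast
            rw [add_comm]
          rw [h3] at h1
          have h4 := (abs_le.1 h1).2
          have h5 : (n : ℝ) / p * cntR (RP (C (W : ℤ) * X + C 1)) p ≤ (n : ℝ) / p * 1 := by gcongr
          linarith
      _ ≤ ∑ p ∈ Finset.Ioc T Q, (((n : ℝ) / p + 1) * (1 / p)) :=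
          Finset.sum_le_sum_of_subset_of_nonneg (Finset.filter_subset _ _) fun _ _ _ => by positivity
      _ = n * ∑ p ∈ Finset.Ioc T Q, ((p : ℝ) ^ 2)⁻¹ + ∑ p ∈ Finset.Ioc T Q, (p : ℝ)⁻¹ := by
          rw [Finset.mul_sum, ← Finset.sum_add_distrib]
          refine Finset.sum_congr rfl fun p hp => ?_
          have : (p : ℝ) ≠ 0 := by
            have := Finset.mem_Ioc.1 hp
            exact_mod_cast (by omega : p ≠ 0)
          field_simp
      _ ≤ _ := by
          have h1 := sum_Ioc_inv_sq_le_sub (α := ℝ) hT hTQ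
          have h2 : (0 : ℝ) ≤ (Q : ℝ)⁻¹ := by positivity
          have h3 : (n : ℝ) * ∑ p ∈ Finset.Ioc T Q, ((p : ℝ) ^ 2)⁻¹ ≤ n * (T : ℝ)⁻¹ := by
            gcongr; linarith
          have h4 : ∑ p ∈ Finset.Ioc T Q, (p : ℝ)⁻¹ ≤ ∑ p ∈ Finset.Icc 1 Q, (p : ℝ)⁻¹ := by
            refine Finset.sum_le_sum_of_subset_of_nonneg ?_ fun _ _ _ => by positivity
            intro x hx
            rw [Finset.mem_Ioc] at hx
            rw [Finset.mem_Icc]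
            omega
          have h5 := harmonic_le_one_add_log Q
          rw [harmonic_eq_sum_Icc] at h5
          push_cast at h5
          rw [← div_eq_mul_inv] at h3
          linarith
  · intro j p
    simp only [Finset.mem_Icc, Nat.mem_primeFactors, Finset.mem_filter, Finset.mem_Ioc]
    constructor
    · rintro ⟨⟨h1, h2⟩, hp, hd, -⟩
      refine ⟨⟨⟨h1, h2⟩, hd⟩, ⟨?_, ?_⟩, hp⟩
      · by_contra hle
        have : p ∣ W := hW ▸ (hp.dvd_factorial.2 (by omega))
        have h3 : p ∣ 1 := (Nat.dvd_add_left (this.mul_right j)).1 hd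
        exact hp.one_lt.ne' (Nat.dvd_one.1 h3)
      · refine (Nat.le_of_dvd (by omega) hd).trans (le_trans ?_ hn)
        gcongr
    · rintro ⟨⟨h1, hd⟩, h2, hp⟩
      exact ⟨h1, hp, hd, by omega⟩

theorem N_lower_aux (P : ℤ[X]) (hP : P ≠ 0) :
    ∃ c : ℝ, 0 < c ∧ ∀ᶠ Q : ℕ in atTop, c * (Q : ℝ) ^ 2 ≤ (fareyPairs P Q).card := by
  classical
  set D := P.natDegree
  set T := 8 * D + P.leadingCoeff.natAbs + 1 with hT
  set W := T.factorial with hW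
  have hW0 : 0 < W := Nat.factorial_pos T
  have hW0' : (0 : ℝ) < W := by exact_mod_cast hW0
  refine ⟨1 / (32 * W), by positivity, ?_⟩
  have hlog : ∀ᶠ Q : ℕ in atTop, (D : ℝ) * (1 + Real.log Q) ≤ Q / (32 * W) := by
    have h1 : Tendsto (fun x : ℝ => (1 + Real.log x) / x) atTop (nhds 0) := by
      have h2 : Tendsto (fun x : ℝ => Real.log x / x) atTop (nhds 0) :=
        Real.isLittleO_log_id_atTop.tendsto_div_nhds_zero
      have := tendsto_inv_atTop_zero.add h2
      rw [add_zero] at this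
      refine this.congr fun x => ?_
      rw [add_div, one_div]
    have h3 := (h1.const_mul (D : ℝ)).comp (tendsto_natCast_atTop_atTop (R := ℝ))
    rw [mul_zero] at h3
    have h4 := h3.eventually (gt_mem_nhds (show (0 : ℝ) < 1 / (32 * W) by positivity))
    filter_upwards [h4, eventually_gt_atTop 0] with Q hQ hQ0
    have hQ0' : (0 : ℝ) < Q := by exact_mod_cast hQ0
    simp only [Function.comp] at hQ
    rw [mul_div_assoc', div_lt_iff₀ hQ0'] at hQ
    refine hQ.le.trans (le_of_eq ?_)
    ring
  filter_upwards [hlog, eventually_ge_atTop (2 * W), eventually_ge_atTop T] with Q hQ hQW hQT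
  set n := (Q - 1) / W with hn
  have n1 : 1 + W * n ≤ Q := by
    have h : W * n ≤ Q - 1 := Nat.mul_div_le (Q - 1) W
    clear_value n
    generalize W * n = m at *
    omega
  have n2 : Q ≤ W * n + W := by
    have h : Q - 1 < W * (n + 1) := Nat.lt_mul_div_succ (Q - 1) hW0
    rw [mul_add, mul_one] at h
    clear_value n
    generalize W * n = m at *
    omega
  have hps := prime_sum T W Q n (by omega) hQT hW n1
  have hN : ∑ j ∈ Finset.Icc 1 n, (Aq P (1 + W * j) (1 + W * j) : ℝ) ≤ (fareyPairs P Q).card := by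
    rw [card_pairs_one]
    push_cast
    refine le_trans (le_of_eq ?_) (Finset.sum_le_sum_of_subset_of_nonneg
      (s := (Finset.Icc 1 n).image (fun j => 1 + W * j)) ?_ fun _ _ _ => by positivity)
    · rw [Finset.sum_image]
      intro a _ b _ hab
      simpa [hW0.ne'] using hab
    · intro q hq
      obtain ⟨j, hj, rfl⟩ := Finset.mem_image.1 hq
      have hj := Finset.mem_Icc.1 hj
      rw [Finset.mem_Icc]
      refine ⟨by omega, le_trans ?_ n1⟩
      gcongr
      exact hj.2
  have hA : ∀ j ∈ Finset.Icc 1 n, (W : ℝ) * j - D * Q * ∑ p ∈ (1 + W * j).primeFactors, (1 : ℝ) / p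
      ≤ (Aq P (1 + W * j) (1 + W * j) : ℝ) := by
    intro j hj
    have hj := Finset.mem_Icc.1 hj
    have hqQ : 1 + W * j ≤ Q := le_trans (by gcongr; exact hj.2) n1
    have h1 := Aq_lower P (1 + W * j) (by omega)
    have h2 : ∑ p ∈ (1 + W * j).primeFactors, ((1 + W * j : ℕ) : ℝ) / p * cntR (RP P) p ≤
        D * Q * ∑ p ∈ (1 + W * j).primeFactors, (1 : ℝ) / p := by
      rw [Finset.mul_sum]
      refine Finset.sum_le_sum fun p hp => ?_
      have hp := Nat.mem_primeFactors.1 hp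
      have hpT : T < p := by
        by_contra hle
        have : p ∣ W := hW ▸ (hp.1.dvd_factorial.2 (by omega))
        have h3 : p ∣ 1 := (Nat.dvd_add_left (this.mul_right j)).1 hp.2.1
        exact hp.1.one_lt.ne' (Nat.dvd_one.1 h3)
      have hf := cntR_prime_le P p hp.1 (by
        intro hd
        have h5 := Nat.le_of_dvd (by simpa using hP) (Int.natCast_dvd.1 hd)
        omega)
      have hf' : (cntR (RP P) p : ℝ) ≤ D := by exact_mod_cast hf
      have hqQ' : ((1 + W * j : ℕ) : ℝ) ≤ Q := by exact_mod_cast hqQ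
      calc ((1 + W * j : ℕ) : ℝ) / p * cntR (RP P) p ≤ (Q : ℝ) / p * D := by gcongr
        _ = _ := by ring
    push_cast at h1 h2
    linarith
  have hsum := (Finset.sum_le_sum hA).trans hN
  rw [Finset.sum_sub_distrib, ← Finset.mul_sum, ← Finset.mul_sum] at hsum
  have hg : ∑ j ∈ Finset.Icc 1 n, (j : ℝ) = n * (n + 1) / 2 := by
    have : ∀ m : ℕ, ∑ j ∈ Finset.Icc 1 m, (j : ℝ) = m * (m + 1) / 2 := by
      intro m
      induction m with
      | zero => simp
      | succ m ih =>
        rw [Finset.sum_Icc_succ_top (by omega), ih]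
        push_cast
        ring
    exact this n
  rw [hg] at hsum
  have hDQ : (0 : ℝ) ≤ D * Q := by positivity
  have h6 := mul_le_mul_of_nonneg_left hps hDQ
  have n2' : (Q : ℝ) ≤ W * n + W := by exact_mod_cast n2
  have hQW' : (2 : ℝ) * W ≤ Q := by exact_mod_cast hQW
  have hT8 : (D : ℝ) / T ≤ 1 / 8 := by
    have hT' : (8 : ℝ) * D ≤ T := by
      have : 8 * D ≤ T := by omega
      exact_mod_cast this
    have hT0 : (0 : ℝ) < T := by exact_mod_cast (by omega : 0 < T)
    rw [div_le_div_iff₀ hT0 (by norm_num)]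
    linarith
  have hQ0 : (0 : ℝ) ≤ Q := by positivity
  have hn0 : (0 : ℝ) ≤ n := by positivity
  have e1 : (D : ℝ) * Q * (n / T + (1 + Real.log Q)) = Q * n * (D / T) + Q * (D * (1 + Real.log Q)) := by
    ring
  have e2 : (Q : ℝ) * n * (D / T) ≤ Q * n * (1 / 8) := by gcongr
  have e3 : (Q : ℝ) * (D * (1 + Real.log Q)) ≤ Q * (Q / (32 * W)) := by gcongr
  have e4 : (W : ℝ) * (n * (n + 1) / 2) ≥ n * Q / 2 := by nlinarith
  have e5 : (Q : ℝ) / (2 * W) ≤ n := by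
    rw [div_le_iff₀ (by positivity)]; nlinarith
  have e6 : (Q : ℝ) * n * (3/8) ≥ Q * (Q / (2 * W)) * (3 / 8) := by gcongr
  have e7 : (Q : ℝ) * (Q / (2 * W)) * (3 / 8) = 6 * (1 / (32 * W) * (Q : ℝ) ^ 2) := by
    field_simp; ring
  have e8 : (Q : ℝ) * (Q / (32 * W)) = 1 / (32 * W) * (Q : ℝ) ^ 2 := by
    field_simp
  have e9 : 0 ≤ 1 / (32 * W) * (Q : ℝ) ^ 2 := by positivity
  linarith

theorem N_pos (P : ℤ[X]) (Q : ℕ) (hQ : 1 ≤ Q) : 1 ≤ (fareyPairs P Q).card := by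
  apply Finset.card_pos.2
  refine ⟨(1, 1), ?_⟩
  simp [fareyPairs, hQ]

theorem N_lower (P : ℤ[X]) (hP : P ≠ 0) :
    ∃ c : ℝ, 0 < c ∧ ∀ Q : ℕ, 1 ≤ Q → c * (Q : ℝ) ^ 2 ≤ (fareyPairs P Q).card := by
  obtain ⟨c, hc, h⟩ := N_lower_aux P hP
  obtain ⟨Q0, h0⟩ := eventually_atTop.1 h
  refine ⟨min c (1 / ((Q0 : ℝ) + 1) ^ 2), by positivity, fun Q hQ => ?_⟩
  by_cases hq : Q0 ≤ Q
  · refine le_trans ?_ (h0 Q hq)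
    gcongr
    exact min_le_left _ _
  · have h1 : (1 : ℝ) ≤ (fareyPairs P Q).card := by exact_mod_cast N_pos P Q hQ
    refine le_trans ?_ h1
    calc min c (1 / ((Q0 : ℝ) + 1) ^ 2) * (Q : ℝ) ^ 2 ≤ (1 / ((Q0 : ℝ) + 1) ^ 2) * ((Q0 : ℝ) + 1) ^ 2 := by
          have : (Q : ℝ) ≤ Q0 + 1 := by exact_mod_cast (by omega : Q ≤ Q0 + 1)
          gcongr
          exact min_le_right _ _
      _ = 1 := by field_simp
end Lower


/-- **Theorem (Discrepancy of polynomial Farey fractions).**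
If `P(X) = c_ν X^ν + ⋯ + c_1 X` with `ν ≥ 2` has nonzero discriminant (equivalently,
`P` is separable over `ℚ`), and `J` is the number of distinct irreducible factors of `P`,
then `C₁/Q ≤ D_{N_{Q,P}}(F_{Q,P}) ≤ C₂ (log Q)^J / Q` for all `Q ≥ 2`. -/
theorem discrepancy_polyFarey (ν : ℕ) (hν : 2 ≤ ν) (c : ℕ → ℤ) (hc : c ν ≠ 0)
    (P : Polynomial ℤ)
    (hP : P = ∑ i ∈ Finset.Icc 1 ν, Polynomial.C (c i) * Polynomial.X ^ i)
    (hdisc : (P.map (Int.castRingHom ℚ)).Separable) :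
    ∃ C₁ C₂ : ℝ, 0 < C₁ ∧ 0 < C₂ ∧ ∀ Q : ℕ, 2 ≤ Q →
      C₁ / (Q : ℝ) ≤ discrepancy P Q ∧
      discrepancy P Q ≤ C₂ * (Real.log Q) ^ (numIrredFactors P) / (Q : ℝ) := by
  classical
  have hP0 : P ≠ 0 := by
    intro h
    rw [h, Polynomial.map_zero] at hdisc
    exact hdisc.ne_zero rfl
  obtain ⟨C, hC, hSR⟩ := SR_main P hdisc
  obtain ⟨c', hc', hN⟩ := N_lower P hP0
  refine ⟨1 / 2, C / c', by norm_num, by positivity, fun Q hQ => ?_⟩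
  have hQ0 : (0 : ℝ) < Q := by exact_mod_cast (by omega : 0 < Q)
  have hNQ := hN Q (by omega)
  have hNpos : (0 : ℝ) < (fareyPairs P Q).card := lt_of_lt_of_le (by positivity) hNQ
  have hub : ∀ α : Set.Icc (0 : ℝ) 1,
      |(((fareyPairs P Q).filter (fun x => ((x.1 : ℝ) / (x.2 : ℝ)) ≤ (α : ℝ))).card : ℝ) /
        ((fareyPairs P Q).card : ℝ) - (α : ℝ)| ≤
        C / c' * (Real.log Q) ^ (numIrredFactors P) / (Q : ℝ) := by
    rintro ⟨α, h0, h1⟩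
    have h2 := disc_upper P Q α h0 h1
    have h3 : SR (RP P) Q ≤ C * Real.log Q ^ numIrredFactors P := hSR Q hQ
    have hS0 : 0 ≤ C * Real.log Q ^ numIrredFactors P := (SR_nonneg _ _).trans h3
    have e : (((fareyPairs P Q).filter (fun x => ((x.1 : ℝ) / (x.2 : ℝ)) ≤ α)).card : ℝ) /
        ((fareyPairs P Q).card : ℝ) - α =
        ((((fareyPairs P Q).filter (fun x => ((x.1 : ℝ) / (x.2 : ℝ)) ≤ α)).card : ℝ)
          - α * (fareyPairs P Q).card) / (fareyPairs P Q).card := by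
      field_simp
    simp only
    rw [e, abs_div, abs_of_pos hNpos]
    calc _ ≤ (Q * (C * Real.log Q ^ numIrredFactors P)) / (c' * (Q : ℝ) ^ 2) := by
          refine div_le_div₀ (by positivity) (h2.trans ?_) (by positivity) hNQ
          gcongr
      _ = _ := by field_simp
  constructor
  · have hbdd : BddAbove (Set.range fun α : Set.Icc (0 : ℝ) 1 =>
      |(((fareyPairs P Q).filter (fun x => ((x.1 : ℝ) / (x.2 : ℝ)) ≤ (α : ℝ))).card : ℝ) /
        ((fareyPairs P Q).card : ℝ) - (α : ℝ)|) := by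
      refine ⟨C / c' * (Real.log Q) ^ (numIrredFactors P) / (Q : ℝ), ?_⟩
      rintro _ ⟨α, rfl⟩
      exact hub α
    have hmem : (1 / 2 / (Q : ℝ)) ∈ Set.Icc (0 : ℝ) 1 := by
      refine ⟨by positivity, ?_⟩
      rw [div_le_one hQ0]
      have : (2 : ℝ) ≤ Q := by exact_mod_cast hQ
      linarith
    have h1 := le_ciSup hbdd ⟨1 / 2 / (Q : ℝ), hmem⟩
    have h2 : (fareyPairs P Q).filter (fun x => ((x.1 : ℝ) / (x.2 : ℝ)) ≤ 1 / 2 / (Q : ℝ)) = ∅ := by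
      rw [Finset.filter_eq_empty_iff]
      intro x hx
      simp only [fareyPairs, Finset.mem_filter, Finset.mem_product, Finset.mem_Icc] at hx
      rw [not_le]
      have hx1 : (1 : ℝ) ≤ x.1 := by exact_mod_cast hx.1.1.1
      have hx2 : (1 : ℝ) ≤ x.2 := by exact_mod_cast hx.1.2.1
      have hx3 : (x.2 : ℝ) ≤ Q := by exact_mod_cast hx.1.2.2
      rw [div_lt_div_iff₀ hQ0 (by linarith)]
      nlinarith
    simp only [h2, Finset.card_empty, Nat.cast_zero, zero_div, zero_sub, abs_neg] at h1
    rw [abs_of_nonneg hmem.1] at h1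
    exact h1
  · have : Nonempty (Set.Icc (0 : ℝ) 1) := ⟨⟨0, by simp⟩⟩
    exact ciSup_le hub
end

section
/- Let ν ≥ 2 be an integer and let P(X) = c_ν X^ν + c_{ν−1} X^{ν−1} + ⋯ + c_1 X ∈ ℤ[X] be a polynomial with nonzero discriminant. Then the sequence of finite sets (F_{Q,P})_{Q ≥ 1} is uniformly distributed modulo one: for every α ∈ [0,1], the ratio #(F_{Q,P} ∩ [0,α]) / #F_{Q,P} tends to α as Q → ∞. -/
open Finset Filter

theorem rat_inj {a q b r : ℕ} (hq : 0 < q) (hr : 0 < r) (h1 : Nat.Coprime a q) (h2 : Nat.Coprime b r)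
    (h : (a : ℚ) / q = (b : ℚ) / r) : a = b ∧ q = r := by
  have hq' : (q : ℚ) ≠ 0 := by positivity
  have hr' : (r : ℚ) ≠ 0 := by positivity
  rw [div_eq_div_iff hq' hr'] at h
  have h' : a * r = b * q := by exact_mod_cast h
  have hqr : q ∣ r := h1.symm.dvd_of_dvd_mul_left (Dvd.intro_left b h'.symm)
  have hrq : r ∣ q := h2.symm.dvd_of_dvd_mul_left (Dvd.intro_left a h')
  have e := Nat.dvd_antisymm hqr hrq
  subst e
  exact ⟨Nat.eq_of_mul_eq_mul_right hq h', rfl⟩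

theorem cop_of_gcd {P : Polynomial ℤ} (h0 : P.eval 0 = 0) {a q : ℕ}
    (h : Int.gcd (P.eval (a : ℤ)) (q : ℤ) = 1) : Nat.Coprime a q := by
  have h1 : (a : ℤ) ∣ P.eval (a : ℤ) := by
    have := Polynomial.sub_dvd_eval_sub (a : ℤ) 0 P
    simpa [h0] using this
  have h2 : Int.gcd (a : ℤ) (q : ℤ) ∣ Int.gcd (P.eval (a : ℤ)) (q : ℤ) :=
    Int.gcd_dvd_gcd_of_dvd_left _ h1
  rw [h] at h2
  simpa using h2

open scoped Classical in
theorem card_farey {P : Polynomial ℤ} (h0 : P.eval 0 = 0) (Q : ℕ) (r : ℚ → Prop) :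
    ((fareySet P Q).filter r).card = ∑ q ∈ Icc 1 Q, ((Icc 1 q).filter
      (fun a : ℕ => Int.gcd (P.eval (a : ℤ)) (q : ℤ) = 1 ∧ r ((a : ℚ) / q))).card := by
  unfold fareySet
  rw [filter_image, card_image_of_injOn, fareyPairs, filter_filter, card_filter, sum_product_right]
  · refine sum_congr rfl fun q hq => ?_
    rw [← card_filter]
    congr 1
    ext a
    simp only [mem_filter, mem_Icc] at *
    constructor
    · rintro ⟨h, h2⟩; tauto
    · rintro ⟨h, h2⟩
      refine ⟨⟨h.1, by omega⟩, ?_⟩; tauto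
  · rintro ⟨a, q⟩ h ⟨b, s⟩ h' e
    simp only [fareyPairs, coe_filter, mem_filter, mem_product, mem_Icc, Set.mem_ofPred_eq] at h h' e
    have := rat_inj (by omega) (by omega) (cop_of_gcd h0 h.1.2.2) (cop_of_gcd h0 h'.1.2.2) e
    simp [this]

theorem per_exact (p : ℕ → Prop) [DecidablePred p] (M : ℕ) (hp : Function.Periodic p M) (k : ℕ) :
    ((Icc 1 (M * k)).filter p).card = k * M.count p := by
  induction k with
  | zero => simp
  | succ k ih =>
    have : Icc 1 (M * (k+1)) = Icc 1 (M * k) ∪ Ico (M * k + 1) (M * k + 1 + M) := by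
      ext x; simp only [mem_union, mem_Icc, mem_Ico, mul_add, mul_one];
      generalize M * k = t
      omega
    rw [this, filter_union, card_union_of_disjoint, ih, Nat.filter_Ico_card_eq_of_periodic _ _ _ hp]
    · ring
    · refine disjoint_filter_filter ?_
      rw [Finset.disjoint_left]; intro x; simp only [mem_Icc, mem_Ico]; omega

theorem per_bound (p : ℕ → Prop) [DecidablePred p] (M : ℕ) (hM : 0 < M) (hp : Function.Periodic p M) (n : ℕ) :
    |(((Icc 1 n).filter p).card : ℝ) - n * ((M.count p : ℝ) / M)| ≤ M := by
  have h1 : ((Icc 1 (M * (n / M))).filter p).card ≤ ((Icc 1 n).filter p).card :=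
    card_le_card (filter_subset_filter _ (Icc_subset_Icc_right (Nat.mul_div_le n M)))
  have h2 : ((Icc 1 n).filter p).card ≤ ((Icc 1 (M * (n / M))).filter p).card + n % M := by
    have : (Icc 1 n).filter p ⊆ (Icc 1 (M * (n / M))).filter p ∪ Ioc (M * (n / M)) n := by
      intro x; simp only [mem_union, mem_filter, mem_Icc, mem_Ioc]
      intro h
      by_cases h' : x ≤ M * (n / M)
      · exact Or.inl ⟨⟨h.1.1, h'⟩, h.2⟩
      · exact Or.inr ⟨by omega, h.1.2⟩
    refine (card_le_card this).trans ((card_union_le _ _).trans ?_)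
    have := Nat.div_add_mod n M
    simp only [Nat.card_Ioc]
    omega
  rw [per_exact p M hp] at h1 h2
  have h3 : M.count p ≤ M := Nat.count_le _
  have h4 := Nat.div_add_mod n M
  have h5 := (Nat.mod_lt n hM).le
  generalize n / M = k at *
  generalize n % M = r at *
  generalize M.count p = g at *
  generalize ((Icc 1 n).filter p).card = z at *
  subst h4
  have hM' : (0:ℝ) < M := by exact_mod_cast hM
  have h1' : (k * g : ℝ) ≤ z := by exact_mod_cast h1
  have h2' : (z:ℝ) ≤ k * g + r := by exact_mod_cast h2
  have h3' : (g:ℝ)/M ≤ 1 := by rw [div_le_one hM']; exact_mod_cast h3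
  have h3'' : 0 ≤ (g:ℝ)/M := by positivity
  have h5' : (r:ℝ) ≤ M := by exact_mod_cast h5
  have e : ((M * k + r : ℕ) : ℝ) * ((g:ℝ)/M) = k * g + r * ((g:ℝ)/M) := by
    push_cast; field_simp
  rw [e, abs_le]
  have : (r:ℝ) * ((g:ℝ)/M) ≤ r := mul_le_of_le_one_right (by positivity) h3'
  have : 0 ≤ (r:ℝ) * ((g:ℝ)/M) := by positivity
  constructor <;> linarith

theorem eval_modEq (P : Polynomial ℤ) (d : ℤ) (a m : ℕ) (h : d ∣ m) :
    d ∣ P.eval ((a + m : ℕ) : ℤ) ↔ d ∣ P.eval (a : ℤ) := by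
  have h1 : d ∣ P.eval ((a + m : ℕ) : ℤ) - P.eval (a : ℤ) := by
    refine dvd_trans h ?_
    have := Polynomial.sub_dvd_eval_sub ((a + m : ℕ) : ℤ) (a : ℤ) P
    simpa using this
  exact (dvd_iff_dvd_of_dvd_sub h1)

theorem roots_bound (P : Polynomial ℤ) (ν : ℕ) (hdeg : P.natDegree ≤ ν) (p : ℕ) (hp : p.Prime)
    (hc : ¬ (p : ℤ) ∣ P.coeff ν) :
    p.count (fun a : ℕ => (p : ℤ) ∣ P.eval (a : ℤ)) ≤ ν := by
  have := Fact.mk hp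
  have hne : P.map (Int.castRingHom (ZMod p)) ≠ 0 := by
    intro h
    apply hc
    have := congrArg (fun R => Polynomial.coeff R ν) h
    simp only [Polynomial.coeff_map, Polynomial.coeff_zero] at this
    exact (ZMod.intCast_zmod_eq_zero_iff_dvd _ _).1 (by simpa using this)
  rw [Nat.count_eq_card_filter_range]
  calc _ ≤ (P.map (Int.castRingHom (ZMod p))).roots.toFinset.card := by
        refine card_le_card_of_injOn (fun a : ℕ => (a : ZMod p)) ?_ ?_
        · intro a ha
          simp only [coe_filter, mem_range, Set.mem_ofPred_eq] at ha
          simp only [mem_coe, Multiset.mem_toFinset, Polynomial.mem_roots hne, Polynomial.IsRoot]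
          have := (ZMod.intCast_zmod_eq_zero_iff_dvd (P.eval (a:ℤ)) p).2 ha.2
          rw [← this]
          have := Polynomial.eval_intCast_map (Int.castRingHom (ZMod p)) P (a:ℤ)
          simpa using this
        · intro a ha b hb h
          simp only [coe_filter, mem_range, Set.mem_ofPred_eq] at ha hb
          have := (ZMod.natCast_eq_natCast_iff' a b p).1 h
          rwa [Nat.mod_eq_of_lt ha.1, Nat.mod_eq_of_lt hb.1] at this
    _ ≤ _ := Multiset.toFinset_card_le _
    _ ≤ _ := Polynomial.card_roots' _
    _ ≤ _ := Polynomial.natDegree_map_le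
    _ ≤ ν := hdeg

theorem bad_prime (P : Polynomial ℤ) (ν : ℕ) (hdeg : P.natDegree ≤ ν) (p : ℕ) (hp : p.Prime)
    (hc : ¬ (p : ℤ) ∣ P.coeff ν) (q : ℕ) (hq : p ∣ q) :
    (((Icc 1 q).filter (fun a : ℕ => (p : ℤ) ∣ P.eval (a : ℤ))).card : ℝ) ≤ ν * q / p := by
  obtain ⟨k, rfl⟩ := hq
  rw [per_exact]
  · have := roots_bound P ν hdeg p hp hc
    have hp' : (0:ℝ) < p := by exact_mod_cast hp.pos
    rw [le_div_iff₀ hp']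
    have : (p.count (fun a : ℕ => (p : ℤ) ∣ P.eval (a : ℤ)) : ℝ) ≤ ν := by exact_mod_cast this
    push_cast
    calc _ ≤ (k : ℝ) * ν * p := by gcongr
      _ = _ := by ring
  · intro a
    exact propext (eval_modEq P p a p dvd_rfl)

open scoped Classical in
/-- pairs excluded by a prime larger than Y -/
theorem bad_q (P : Polynomial ℤ) (ν : ℕ) (hdeg : P.natDegree ≤ ν) (Y : ℕ)
    (hc : ∀ p : ℕ, p.Prime → Y < p → ¬ (p : ℤ) ∣ P.coeff ν) (Q q : ℕ) (hq : 1 ≤ q) (hqQ : q ≤ Q) :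
    (((Icc 1 q).filter (fun a : ℕ => ∃ p : ℕ, p.Prime ∧ Y < p ∧ p ∣ q ∧ (p : ℤ) ∣ P.eval (a : ℤ))).card : ℝ)
      ≤ ∑ n ∈ (Ioc Y Q).filter Nat.Prime, if n ∣ q then (ν : ℝ) * Q / n else 0 := by
  have hsub : (Icc 1 q).filter (fun a : ℕ => ∃ p : ℕ, p.Prime ∧ Y < p ∧ p ∣ q ∧ (p : ℤ) ∣ P.eval (a : ℤ))
      ⊆ (((Ioc Y Q).filter Nat.Prime).filter (fun n => n ∣ q)).biUnion
        (fun p => (Icc 1 q).filter (fun a : ℕ => (p : ℤ) ∣ P.eval (a : ℤ))) := by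
    intro a
    simp only [mem_filter, mem_biUnion, mem_Ioc]
    rintro ⟨h, p, h1, h2, h3, h4⟩
    exact ⟨p, ⟨⟨⟨h2, (Nat.le_of_dvd hq h3).trans hqQ⟩, h1⟩, h3⟩, h, h4⟩
  have h1 := (card_le_card hsub).trans card_biUnion_le
  have h2 := (Nat.cast_le (α := ℝ)).2 h1
  refine h2.trans ?_
  rw [← sum_filter]
  push_cast
  refine sum_le_sum fun p hp => ?_
  simp only [mem_filter, mem_Ioc] at hp
  refine (bad_prime P ν hdeg p hp.1.2 (hc p hp.1.2 hp.1.1.1) q hp.2).trans ?_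
  gcongr

theorem card_mult_le (n Q : ℕ) : ((Icc 1 Q).filter (fun q => n ∣ q)).card ≤ Q / n := by
  have := Nat.Ioc_filter_dvd_card_eq_div Q n
  rw [← this]
  exact le_of_eq rfl

open scoped Classical in
theorem sum_bad (P : Polynomial ℤ) (ν : ℕ) (hdeg : P.natDegree ≤ ν) (Y : ℕ) (hY : 1 ≤ Y)
    (hc : ∀ p : ℕ, p.Prime → Y < p → ¬ (p : ℤ) ∣ P.coeff ν) (Q : ℕ) (hQ : Y ≤ Q) :
    ∑ q ∈ Icc 1 Q, (((Icc 1 q).filter (fun a : ℕ => ∃ p : ℕ, p.Prime ∧ Y < p ∧ p ∣ q ∧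
      (p : ℤ) ∣ P.eval (a : ℤ))).card : ℝ) ≤ ν * Q ^ 2 / Y := by
  calc _ ≤ ∑ q ∈ Icc 1 Q, ∑ n ∈ (Ioc Y Q).filter Nat.Prime, (if n ∣ q then (ν : ℝ) * Q / n else 0) :=
        sum_le_sum fun q hq => bad_q P ν hdeg Y hc Q q (mem_Icc.1 hq).1 (mem_Icc.1 hq).2
    _ ≤ ∑ q ∈ Icc 1 Q, ∑ n ∈ Ioc Y Q, (if n ∣ q then (ν : ℝ) * Q / n else 0) := by
        refine sum_le_sum fun q hq => sum_le_sum_of_subset_of_nonneg (filter_subset _ _) ?_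
        intros; split_ifs <;> positivity
    _ = ∑ n ∈ Ioc Y Q, ∑ q ∈ Icc 1 Q, (if n ∣ q then (ν : ℝ) * Q / n else 0) := sum_comm
    _ ≤ ∑ n ∈ Ioc Y Q, ν * (Q:ℝ) ^ 2 * ((n:ℝ) ^ 2)⁻¹ := by
        refine sum_le_sum fun n hn => ?_
        rw [← sum_filter, sum_const, nsmul_eq_mul]
        have hn0 : (0:ℝ) < n := by
          have := (mem_Ioc.1 hn).1
          exact_mod_cast (by omega : 0 < n)
        have h1 : (((Icc 1 Q).filter (fun q => n ∣ q)).card : ℝ) ≤ (Q:ℝ) / n :=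
          ((Nat.cast_le (α := ℝ)).2 (card_mult_le n Q)).trans Nat.cast_div_le
        calc _ ≤ (Q:ℝ) / n * (ν * Q / n) := by gcongr
          _ = _ := by field_simp
    _ = ν * (Q:ℝ) ^ 2 * ∑ n ∈ Ioc Y Q, ((n:ℝ) ^ 2)⁻¹ := by rw [mul_sum]
    _ ≤ ν * (Q:ℝ) ^ 2 * (Y:ℝ)⁻¹ := by
        gcongr
        refine (sum_Ioc_inv_sq_le_sub (by omega) hQ).trans ?_
        simp
    _ = _ := by rw [div_eq_mul_inv]

open scoped Classical in
theorem per_alpha (p : ℕ → Prop) (M : ℕ) (hM : 0 < M) (hp : Function.Periodic p M) (q : ℕ)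
    (α : ℝ) (h0 : 0 ≤ α) (h1 : α ≤ 1) :
    |(((Icc 1 q).filter (fun a : ℕ => p a ∧ (a : ℝ) ≤ α * q)).card : ℝ)
      - α * ((Icc 1 q).filter p).card| ≤ 2 * M + 1 := by
  have hs : (Icc 1 q).filter (fun a : ℕ => p a ∧ (a : ℝ) ≤ α * q) = (Icc 1 ⌊α * q⌋₊).filter p := by
    ext a
    simp only [mem_filter, mem_Icc]
    rw [Nat.le_floor_iff (by positivity)]
    constructor
    · tauto
    · rintro ⟨⟨h, h2⟩, h3⟩
      refine ⟨⟨h, ?_⟩, h3, h2⟩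
      have : (a:ℝ) ≤ q := h2.trans (mul_le_of_le_one_left (by positivity) h1)
      exact_mod_cast this
  rw [hs]
  have e1 := per_bound p M hM hp ⌊α * q⌋₊
  have e2 := per_bound p M hM hp q
  have f1 := Nat.floor_le (a := α * q) (by positivity)
  have f2 := (Nat.lt_floor_add_one (α * q)).le
  have hM' : (0:ℝ) < M := by exact_mod_cast hM
  have g1 : (M.count p : ℝ)/M ≤ 1 := by
    rw [div_le_one hM']; exact_mod_cast Nat.count_le _
  have g0 : 0 ≤ (M.count p : ℝ)/M := by positivity
  generalize (M.count p : ℝ)/M = g at *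
  generalize (⌊α * q⌋₊ : ℝ) = n at *
  generalize (((Icc 1 ⌊α * q⌋₊).filter p).card : ℝ) = z at *
  generalize (((Icc 1 q).filter p).card : ℝ) = w at *
  rw [abs_le] at *
  have a1 : α * (w - q * g) ≤ M := by nlinarith
  have a2 : -(M:ℝ) ≤ α * (w - q * g) := by nlinarith
  have b1 : 0 ≤ (α * q - n) * g := mul_nonneg (by linarith) g0
  have b2 : (α * q - n) * g ≤ 1 := by nlinarith
  constructor <;> nlinarith

theorem gcd_one_iff (x : ℤ) (q : ℕ) :
    Int.gcd x q = 1 ↔ ∀ p : ℕ, p.Prime → p ∣ q → ¬ (p : ℤ) ∣ x := by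
  rw [Int.gcd_eq_natAbs, Int.natAbs_natCast]
  constructor
  · intro h p hp h1 h2
    have : p ∣ Nat.gcd x.natAbs q := Nat.dvd_gcd (Int.natCast_dvd.1 h2) h1
    rw [h] at this
    exact hp.one_lt.ne' (Nat.dvd_one.1 this)
  · intro h
    refine Nat.coprime_of_dvd fun p hp h1 h2 => h p hp h2 (Int.natCast_dvd.2 h1)

open scoped Classical in
theorem diff_q (P : Polynomial ℤ) (Y : ℕ) (q : ℕ)
    (α : ℝ) (h0 : 0 ≤ α) (h1 : α ≤ 1) :
    |(((Icc 1 q).filter (fun a : ℕ => Int.gcd (P.eval (a : ℤ)) (q : ℤ) = 1 ∧ (a : ℝ) ≤ α * q)).card : ℝ)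
      - α * ((Icc 1 q).filter (fun a : ℕ => Int.gcd (P.eval (a : ℤ)) (q : ℤ) = 1)).card|
    ≤ 2 * (Y.factorial : ℝ) + 1 + ((Icc 1 q).filter (fun a : ℕ => ∃ p : ℕ, p.Prime ∧ Y < p ∧ p ∣ q ∧
      (p : ℤ) ∣ P.eval (a : ℤ))).card := by
  set A : ℕ → Prop := fun a => ∀ p : ℕ, p.Prime → p ≤ Y → p ∣ q → ¬ (p : ℤ) ∣ P.eval (a : ℤ) with hA
  set B : ℕ → Prop := fun a => ∃ p : ℕ, p.Prime ∧ Y < p ∧ p ∣ q ∧ (p : ℤ) ∣ P.eval (a : ℤ) with hB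
  have hG : ∀ a : ℕ, Int.gcd (P.eval (a : ℤ)) (q : ℤ) = 1 ↔ A a ∧ ¬ B a := by
    intro a
    rw [gcd_one_iff _ _]
    simp only [hA, hB]
    push Not
    constructor
    · intro h; exact ⟨fun p hp _ => h p hp, fun p hp _ => h p hp⟩
    · rintro ⟨h, h'⟩ p hp
      rcases le_or_gt p Y with h2 | h2
      · exact h p hp h2
      · exact h' p hp h2
  have hper : Function.Periodic A Y.factorial := by
    intro a
    simp only [hA, eq_iff_iff]
    refine forall_congr' fun p => forall_congr' fun hp => forall_congr' fun hpY => ?_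
    rw [eval_modEq]
    exact_mod_cast (hp.dvd_factorial.2 hpY)
  have key := per_alpha A _ Y.factorial_pos hper q α h0 h1
  have c1 : ∀ r : ℕ → Prop, ((Icc 1 q).filter (fun a => (A a ∧ ¬ B a) ∧ r a)).card ≤
     ((Icc 1 q).filter (fun a => A a ∧ r a)).card := fun r =>
    card_le_card (monotone_filter_right _ fun a _ h => ⟨h.1.1, h.2⟩)
  have c2 : ∀ r : ℕ → Prop, ((Icc 1 q).filter (fun a => A a ∧ r a)).card ≤
    ((Icc 1 q).filter (fun a => (A a ∧ ¬ B a) ∧ r a)).card + ((Icc 1 q).filter B).card := by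
    intro r
    refine (card_le_card ?_).trans (card_union_le _ _)
    intro a
    simp only [mem_filter, mem_union]
    tauto
  have d1 := c1 (fun a => (a:ℝ) ≤ α * q)
  have d2 := c2 (fun a => (a:ℝ) ≤ α * q)
  have d3 := c1 (fun a => True)
  have d4 := c2 (fun a => True)
  simp only [and_true] at d3 d4
  simp only [hG]
  rify at d1 d2 d3 d4
  rw [abs_le] at *
  have := mul_le_mul_of_nonneg_left d3 h0
  have := mul_le_mul_of_nonneg_left d4 h0
  have hBn : (0:ℝ) ≤ ((Icc 1 q).filter B).card := by positivity
  have := mul_le_of_le_one_left hBn h1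
  constructor
  · linarith
  · linarith

theorem card_prog (n M K : ℕ) (hn : 0 < n) (hco : Nat.Coprime n M) :
    (((range K).filter (fun k => n ∣ 1 + k * M)).card : ℝ) ≤ (K : ℝ) / n + 1 := by
  rcases ((range K).filter (fun k => n ∣ 1 + k * M)).eq_empty_or_nonempty with h | ⟨v, hv⟩
  · rw [h]; simp; positivity
  · have h1 : ((range K).filter (fun k => n ∣ 1 + k * M)).card ≤ K / n + 1 := by
      have h2 := Nat.count_modEq_card K hn v
      have h3 : ((range K).filter (fun k => n ∣ 1 + k * M)).card ≤ K.count (· ≡ v [MOD n]) := by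
        rw [Nat.count_eq_card_filter_range]
        refine card_le_card (monotone_filter_right _ fun k _ h => ?_)
        have hv' := (mem_filter.1 hv).2
        have : 1 + k * M ≡ 1 + v * M [MOD n] :=
          ((Nat.modEq_zero_iff_dvd).2 h).trans ((Nat.modEq_zero_iff_dvd).2 hv').symm
        exact Nat.ModEq.cancel_right_of_coprime hco (Nat.ModEq.add_left_cancel' 1 this)
      rw [h2] at h3
      refine h3.trans ?_
      split_ifs <;> omega
    have h1' := (Nat.cast_le (α := ℝ)).2 h1
    refine h1'.trans ?_
    push_cast
    gcongr
    exact Nat.cast_div_le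

theorem sum_inv_le (Y Q : ℕ) : ∑ n ∈ Ioc Y Q, (1:ℝ) / n ≤ 1 + Real.log Q := by
  refine le_trans ?_ (harmonic_le_one_add_log Q)
  rw [harmonic_eq_sum_Icc]
  push_cast
  refine (sum_le_sum_of_subset_of_nonneg (t := Icc 1 Q) ?_ ?_).trans (le_of_eq ?_)
  · intro x; simp only [mem_Ioc, mem_Icc]; omega
  · intros; positivity
  · simp

open scoped Classical in
theorem lower_raw (P : Polynomial ℤ) (ν : ℕ) (hdeg : P.natDegree ≤ ν) (Y : ℕ) (hY : 1 ≤ Y)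
    (hc : ∀ p : ℕ, p.Prime → Y < p → ¬ (p : ℤ) ∣ P.coeff ν) (Q K : ℕ) (hQ : Y ≤ Q)
    (hK : K * Y.factorial ≤ Q) :
    (Y.factorial : ℝ) * (K * (K - 1) / 2) - ν * Q * K / Y - ν * Q * (1 + Real.log Q) ≤
    ∑ q ∈ Icc 1 Q, (((Icc 1 q).filter (fun a : ℕ => Int.gcd (P.eval (a : ℤ)) (q : ℤ) = 1)).card : ℝ) := by
  set M := Y.factorial with hM
  have hM0 : 0 < M := Y.factorial_pos
  have hle : ∀ k ∈ range K, 1 + k * M ≤ Q := by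
    intro k hk
    have h1 : (k + 1) * M ≤ K * M := Nat.mul_le_mul_right _ (mem_range.1 hk)
    have : (k + 1) * M = k * M + M := by ring
    omega
  set B : ℕ → ℕ := fun q => ((Icc 1 q).filter (fun a : ℕ => ∃ p : ℕ, p.Prime ∧ Y < p ∧ p ∣ q ∧
      (p : ℤ) ∣ P.eval (a : ℤ))).card with hB
  have hBs : ∑ k ∈ range K, (B (1 + k * M) : ℝ) ≤ ν * Q * K / Y + ν * Q * (1 + Real.log Q) := by
    calc _ ≤ ∑ k ∈ range K, ∑ n ∈ (Ioc Y Q).filter Nat.Prime,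
          (if n ∣ 1 + k * M then (ν : ℝ) * Q / n else 0) :=
          sum_le_sum fun k hk => bad_q P ν hdeg Y hc Q _ (by omega) (hle k hk)
      _ = ∑ n ∈ (Ioc Y Q).filter Nat.Prime, ∑ k ∈ range K,
          (if n ∣ 1 + k * M then (ν : ℝ) * Q / n else 0) := sum_comm
      _ ≤ ∑ n ∈ (Ioc Y Q).filter Nat.Prime, (ν * Q * K * ((n:ℝ) ^ 2)⁻¹ + ν * Q * (1 / n)) := by
          refine sum_le_sum fun n hn => ?_
          rw [← sum_filter, sum_const, nsmul_eq_mul]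
          simp only [mem_filter, mem_Ioc] at hn
          have hn0 : (0:ℝ) < n := by exact_mod_cast hn.2.pos
          have hco : Nat.Coprime n M := by
            rw [Nat.Prime.coprime_iff_not_dvd hn.2, hM, hn.2.dvd_factorial]
            omega
          have := card_prog n M K hn.2.pos hco
          calc _ ≤ ((K:ℝ) / n + 1) * (ν * Q / n) := by gcongr
            _ = _ := by field_simp
      _ ≤ ∑ n ∈ Ioc Y Q, (ν * Q * K * ((n:ℝ) ^ 2)⁻¹ + ν * Q * (1 / n)) := by
          refine sum_le_sum_of_subset_of_nonneg (filter_subset _ _) ?_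
          intros; positivity
      _ = ν * Q * K * ∑ n ∈ Ioc Y Q, ((n:ℝ) ^ 2)⁻¹ + ν * Q * ∑ n ∈ Ioc Y Q, (1 / (n:ℝ)) := by
          rw [sum_add_distrib, mul_sum, mul_sum]
      _ ≤ ν * Q * K * (Y:ℝ)⁻¹ + ν * Q * (1 + Real.log Q) := by
          gcongr
          · refine (sum_Ioc_inv_sq_le_sub (by omega) hQ).trans ?_
            simp
          · exact sum_inv_le Y Q
      _ = _ := by rw [div_eq_mul_inv]
  have hG : ∀ k ∈ range K, ((1 + k * M : ℕ) : ℝ) - B (1 + k * M) ≤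
      (((Icc 1 (1 + k * M)).filter (fun a : ℕ =>
        Int.gcd (P.eval (a : ℤ)) ((1 + k * M : ℕ) : ℤ) = 1)).card : ℝ) := by
    intro k hk
    have : (Icc 1 (1 + k * M)).card ≤ ((Icc 1 (1 + k * M)).filter (fun a : ℕ =>
        Int.gcd (P.eval (a : ℤ)) ((1 + k * M : ℕ) : ℤ) = 1)).card + B (1 + k * M) := by
      refine (card_le_card ?_).trans (card_union_le _ _)
      intro a ha
      simp only [mem_union, mem_filter]
      by_cases h : Int.gcd (P.eval (a : ℤ)) ((1 + k * M : ℕ) : ℤ) = 1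
      · exact Or.inl ⟨ha, h⟩
      · refine Or.inr ⟨ha, ?_⟩
        rw [gcd_one_iff] at h
        push Not at h
        obtain ⟨p, hp, h1, h2⟩ := h
        refine ⟨p, hp, ?_, h1, h2⟩
        by_contra hlt
        have h3 : p ∣ M := hp.dvd_factorial.2 (by omega)
        have h4 : p ∣ 1 := (Nat.dvd_add_left (h3.mul_left k)).1 h1
        exact hp.one_lt.ne' (Nat.dvd_one.1 h4)
    rw [Nat.card_Icc, Nat.add_sub_cancel] at this
    have h' := (Nat.cast_le (α := ℝ)).2 this
    push_cast at h' ⊢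
    linarith
  have hsub : ∑ k ∈ range K, (((Icc 1 (1 + k * M)).filter (fun a : ℕ =>
        Int.gcd (P.eval (a : ℤ)) ((1 + k * M : ℕ) : ℤ) = 1)).card : ℝ) ≤
      ∑ q ∈ Icc 1 Q, (((Icc 1 q).filter (fun a : ℕ => Int.gcd (P.eval (a : ℤ)) (q : ℤ) = 1)).card : ℝ) := by
    have hinj : Set.InjOn (fun k : ℕ => 1 + k * M) (range K) := by
      intro a _ b _ h
      simp only [add_right_inj] at h
      exact Nat.eq_of_mul_eq_mul_right hM0 h
    have e := sum_image (f := fun q : ℕ => (((Icc 1 q).filter (fun a : ℕ => Int.gcd (P.eval (a : ℤ)) (q : ℤ) = 1)).card : ℝ)) hinj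
    rw [← e]
    refine sum_le_sum_of_subset_of_nonneg ?_ ?_
    · intro q hq
      obtain ⟨k, hk, rfl⟩ := mem_image.1 hq
      exact mem_Icc.2 ⟨by omega, hle k hk⟩
    · intros; positivity
  have hlin : (M : ℝ) * (K * (K - 1) / 2) ≤ ∑ k ∈ range K, ((1 + k * M : ℕ) : ℝ) := by
    clear_value M B
    clear hsub hG hBs hle hK
    induction K with
    | zero => simp
    | succ K ih =>
      rw [sum_range_succ]
      push_cast at ih ⊢
      nlinarith
  have := sum_le_sum hG
  rw [sum_sub_distrib] at this
  linarith

open scoped Classical in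
theorem lower (P : Polynomial ℤ) (ν : ℕ) (hν : 1 ≤ ν) (hdeg : P.natDegree ≤ ν) (Y : ℕ) (hY : 1 ≤ Y)
    (hYν : 4 * ν ≤ Y)
    (hc : ∀ p : ℕ, p.Prime → Y < p → ¬ (p : ℤ) ∣ P.coeff ν) :
    ∃ C : ℝ, 0 < C ∧ ∀ᶠ Q : ℕ in atTop, C * (Q:ℝ) ^ 2 ≤
    ∑ q ∈ Icc 1 Q, (((Icc 1 q).filter (fun a : ℕ => Int.gcd (P.eval (a : ℤ)) (q : ℤ) = 1)).card : ℝ) := by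
  have hM : (0:ℝ) < Y.factorial := by exact_mod_cast Y.factorial_pos
  have hν' : (0:ℝ) < ν := by exact_mod_cast hν
  refine ⟨1 / (8 * Y.factorial), by positivity, ?_⟩
  have hlog : ∀ᶠ Q : ℕ in atTop, Real.log Q ≤ 1 / (32 * Y.factorial * ν) * (Q:ℝ) := by
    have := (Real.isLittleO_log_id_atTop.comp_tendsto tendsto_natCast_atTop_atTop).bound
      (show (0:ℝ) < 1 / (32 * Y.factorial * ν) by positivity)
    filter_upwards [this] with Q hQ
    simp only [Function.comp, id, Real.norm_eq_abs, Nat.abs_cast] at hQ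
    exact (le_abs_self _).trans hQ
  filter_upwards [hlog, eventually_ge_atTop Y, eventually_ge_atTop (20 * Y.factorial),
    eventually_ge_atTop (32 * Y.factorial * ν)] with Q h1 h2 h3 h4
  refine le_trans ?_ (lower_raw P ν hdeg Y hY hc Q (Q / Y.factorial) h2 (Nat.div_mul_le_self _ _))
  have hk1 : ((Q / Y.factorial : ℕ) : ℝ) * Y.factorial ≤ Q := by
    exact_mod_cast Nat.div_mul_le_self _ _
  have hk2 : (Q : ℝ) ≤ ((Q / Y.factorial : ℕ) + 1 : ℝ) * Y.factorial := by
    have := (Nat.lt_div_mul_add (a := Q) Y.factorial_pos).le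
    have h' := (Nat.cast_le (α := ℝ)).2 this
    push_cast at h' ⊢
    linarith
  rify at h3 h4 hYν
  have hY' : (0:ℝ) < Y := by exact_mod_cast hY
  generalize ((Q / Y.factorial : ℕ) : ℝ) = K at *
  generalize (Y.factorial : ℝ) = M at *
  generalize Real.log Q = lg at *
  generalize (Q:ℝ) = q at *
  have hq : 0 < q := by linarith
  have hK : 3 ≤ K := by
    by_contra h
    have : (K + 1) * M ≤ 4 * M := by gcongr; linarith
    linarith
  have t1 : ν * q * K / Y ≤ q * K / 4 := by
    rw [div_le_div_iff₀ hY' (by norm_num)]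
    have : 0 ≤ q * K := by positivity
    nlinarith
  have t2 : ν * q * (1 + lg) ≤ q ^ 2 / (16 * M) := by
    have : 1 + lg ≤ 1 / (16 * M * ν) * q := by
      have : 1 ≤ 1 / (32 * M * ν) * q := by
        rw [div_mul_eq_mul_div, one_mul, one_le_div (by positivity)]; exact h4
      have e : 1 / (16 * M * ν) * q = 1 / (32 * M * ν) * q + 1 / (32 * M * ν) * q := by
        field_simp; norm_num
      linarith
    calc _ ≤ ν * q * (1 / (16 * M * ν) * q) := by gcongr
      _ = _ := by field_simp
  have t3 : q ^ 2 / (4 * M) - 5 / 4 * q ≤ M * (K * (K - 1) / 2) - q * K / 4 := by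
    have : q * K ≤ (K + 1) * M * K := by gcongr
    have e : q ^ 2 / (4 * M) - 5 / 4 * q = (q ^ 2 - 5 * M * q) / M / 4 := by field_simp
    have : (q ^ 2 - 5 * M * q) / M ≤ M * K * (K - 3) := by
      rw [div_le_iff₀ hM]
      have u1 : 0 ≤ (K * M - (q - M)) := by linarith
      have u2 : 0 ≤ (K * M - 3 * M - (q - 4 * M)) := by linarith
      have := mul_nonneg u1 (show 0 ≤ K * M - 3 * M by nlinarith)
      have := mul_nonneg u2 (show 0 ≤ q - M by linarith)
      nlinarith [sq_nonneg M]
    rw [e]; nlinarith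
  have t4 : 5 / 4 * q ≤ q ^ 2 / (16 * M) := by
    rw [le_div_iff₀ (by positivity)]
    nlinarith
  have e : 1 / (8 * M) * q ^ 2 = q ^ 2 / (4 * M) - q ^ 2 / (16 * M) - q ^ 2 / (16 * M) := by
    field_simp; norm_num
  rw [e]
  linarith

open scoped Classical in
theorem real_filter_card (F : Finset ℚ) (α : ℝ) :
    (F.filter (fun γ => (γ : ℝ) ≤ α)).card = (F.filter (fun γ : ℚ => (γ : ℝ) ≤ α)).card := by
  symm
  refine card_bij (fun a _ => (a : ℝ)) ?_ ?_ ?_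
  · intro a ha
    simp only [mem_filter] at ha ⊢
    refine ⟨?_, ha.2⟩
    simp only [Finset.bind_def, Finset.pure_def, Finset.mem_sup, mem_singleton]
    exact ⟨a, ha.1, rfl⟩
  · intro a _ b _ h
    exact_mod_cast h
  · intro b hb
    simp only [mem_filter, Finset.bind_def, Finset.pure_def, Finset.mem_sup, mem_singleton] at hb
    obtain ⟨⟨a, ha, rfl⟩, hb⟩ := hb
    exact ⟨a, mem_filter.2 ⟨ha, hb⟩, rfl⟩

open scoped Classical in
/-- **Corollary.** The polynomial Farey fractions are uniformly distributed modulo one: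
for every `α ∈ [0,1]`, `#(F_{Q,P} ∩ [0,α]) / #F_{Q,P} → α` as `Q → ∞`. -/
theorem polyFarey_uniformDistributed (ν : ℕ) (hν : 2 ≤ ν) (c : ℕ → ℤ) (hc : c ν ≠ 0)
    (P : Polynomial ℤ)
    (hP : P = ∑ i ∈ Finset.Icc 1 ν, Polynomial.C (c i) * Polynomial.X ^ i)
    (hdisc : (P.map (Int.castRingHom ℚ)).Separable) :
    ∀ α ∈ Set.Icc (0 : ℝ) 1,
      Tendsto (fun Q : ℕ =>
          (((fareySet P Q).filter (fun γ => (γ : ℝ) ≤ α)).card : ℝ) /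
            ((fareySet P Q).card : ℝ))
        atTop (nhds α) := by
  intro α ⟨hα0, hα1⟩
  have h0 : P.eval 0 = 0 := by
    rw [hP, Polynomial.eval_finsetSum]
    refine sum_eq_zero fun i hi => ?_
    have := (mem_Icc.1 hi).1
    simp [show i ≠ 0 by omega]
  have hdeg : P.natDegree ≤ ν := by
    rw [hP]
    refine Polynomial.natDegree_sum_le_of_forall_le _ _ fun i hi => ?_
    exact (Polynomial.natDegree_C_mul_X_pow_le _ _).trans (mem_Icc.1 hi).2
  have hcoeff : P.coeff ν = c ν := by
    rw [hP, Polynomial.finsetSum_coeff]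
    simp only [Polynomial.coeff_C_mul_X_pow]
    rw [sum_ite_eq, if_pos (mem_Icc.2 ⟨by omega, le_rfl⟩)]
  have hcp : ∀ Y : ℕ, (c ν).natAbs ≤ Y → ∀ p : ℕ, p.Prime → Y < p → ¬ (p : ℤ) ∣ P.coeff ν := by
    intro Y hY p hp hlt hd
    rw [hcoeff] at hd
    have := Nat.le_of_dvd (Int.natAbs_pos.2 hc) (Int.natCast_dvd.1 hd)
    omega
  set N : ℕ → ℝ := fun Q => ∑ q ∈ Icc 1 Q,
    (((Icc 1 q).filter (fun a : ℕ => Int.gcd (P.eval (a : ℤ)) (q : ℤ) = 1)).card : ℝ) with hN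
  set Na : ℕ → ℝ := fun Q => ∑ q ∈ Icc 1 Q,
    (((Icc 1 q).filter (fun a : ℕ => Int.gcd (P.eval (a : ℤ)) (q : ℤ) = 1 ∧ (a : ℝ) ≤ α * q)).card : ℝ) with hNa
  have e1 : ∀ Q, ((fareySet P Q).card : ℝ) = N Q := by
    intro Q
    have := card_farey h0 Q (fun _ => True)
    simp only [filter_true, and_true] at this
    rw [this]
    simp only [hN]
    push_cast
    refine sum_congr rfl fun q _ => ?_
    congr!
  have e2 : ∀ Q, (((fareySet P Q).filter (fun γ => (γ : ℝ) ≤ α)).card : ℝ) = Na Q := by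
    intro Q
    have := card_farey h0 Q (fun γ : ℚ => (γ : ℝ) ≤ α)
    rw [real_filter_card, this]
    simp only [hNa]
    push_cast
    refine sum_congr rfl fun q hq => ?_
    have hq0 : (0:ℝ) < q := by exact_mod_cast (mem_Icc.1 hq).1
    simp only [div_le_iff₀ hq0]
  simp only [e1, e2]
  obtain ⟨C, hC, hlow⟩ := lower P ν (by omega) hdeg (max (max 1 (4 * ν)) (c ν).natAbs)
    (by simp) (by simp) (hcp _ (by simp))
  rw [Metric.tendsto_atTop']
  have main : ∀ ε > 0, ∀ᶠ Q : ℕ in atTop, dist (Na Q / N Q) α < ε := by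
    intro ε hε
    obtain ⟨Y, hY⟩ := exists_nat_ge (max (max 1 ((c ν).natAbs : ℝ)) (ν * 4 / (C * ε)))
    simp only [max_le_iff] at hY
    obtain ⟨⟨hY1, hY2⟩, hY3⟩ := hY
    have hY1' : 1 ≤ Y := by exact_mod_cast hY1
    have hY2' : (c ν).natAbs ≤ Y := by exact_mod_cast hY2
    obtain ⟨Q0, hQ0⟩ := exists_nat_ge ((2 * (Y.factorial : ℝ) + 1) * 4 / (C * ε))
    filter_upwards [hlow, eventually_ge_atTop Y, eventually_ge_atTop Q0, eventually_ge_atTop 1]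
      with Q h1 h2 h3 h4
    have hQpos : (0:ℝ) < Q := by exact_mod_cast h4
    have hNpos : 0 < N Q := lt_of_lt_of_le (by positivity) h1
    have hdiff : |Na Q - α * N Q| ≤ (2 * (Y.factorial : ℝ) + 1) * Q + ν * Q ^ 2 / Y := by
      have hs := sum_bad P ν hdeg Y hY1' (hcp Y hY2') Q h2
      simp only [hNa, hN]
      rw [mul_sum, ← sum_sub_distrib]
      refine (abs_sum_le_sum_abs _ _).trans ?_
      refine (sum_le_sum fun q hq => diff_q P Y q α hα0 hα1).trans ?_
      rw [sum_add_distrib, sum_const, nsmul_eq_mul, Nat.card_Icc]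
      simp only [Nat.add_sub_cancel]
      linarith
    have b1 : (ν : ℝ) * Q ^ 2 / Y ≤ C * ε * Q ^ 2 / 4 := by
      have hYp : (0:ℝ) < Y := by linarith
      rw [div_le_iff₀ (by positivity)] at hY3
      rw [div_le_div_iff₀ hYp (by norm_num)]
      nlinarith [sq_nonneg (Q:ℝ)]
    have b2 : (2 * (Y.factorial : ℝ) + 1) * Q ≤ C * ε * Q ^ 2 / 4 := by
      have h3' : (Q0:ℝ) ≤ Q := by exact_mod_cast h3
      have := hQ0.trans h3'
      rw [div_le_iff₀ (by positivity)] at this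
      nlinarith
    have b3 : |Na Q - α * N Q| < ε * N Q := by
      have : ε * (C * Q ^ 2) ≤ ε * N Q := by gcongr
      have : 0 < ε * (C * (Q:ℝ) ^ 2) := by positivity
      nlinarith
    rw [Real.dist_eq]
    have e : Na Q / N Q - α = (Na Q - α * N Q) / N Q := by field_simp
    rw [e, abs_div, abs_of_pos hNpos, div_lt_iff₀ hNpos]
    exact b3
  intro ε hε
  obtain ⟨n, hn⟩ := eventually_atTop.1 (main ε hε)
  exact ⟨n, fun k hk => hn k hk.le⟩
end

section
/- Let ν ≥ 2 be an integer and let P(X) = c_ν X^ν + ⋯ + c_1 X ∈ ℤ[X] be a polynomial with nonzero discriminant. Then for every Λ > 0, limsup_{Q→∞} S_{F_{Q,P}}(Λ) is finite; moreover there is a constant C > 0 depending only on P such that for every Λ > 0, limsup_{Q→∞} S_{F_{Q,P}}(Λ) ≤ C · ∫_0^Λ λ^{−2} · ( Σ_{1 ≤ m < 2λ/β_P} h(m)·log(2λ/(m·β_P)) ) dλ, where h(m) = Σ_{n·δ·d₁·d₂ = m} n·f_P(d₁)·f_P(d₂) (the sum over all quadruples of positive integers n, δ, d₁, d₂ with product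 m). -/
open Finset Filter

/-- `h(m) = Σ_{n·δ·d₁·d₂ = m} n · f_P(d₁) · f_P(d₂)`, summed over all quadruples of
positive integers with product `m`. -/
def hFun (P : Polynomial ℤ) (m : ℕ) : ℕ :=
  ∑ x ∈ ((Finset.Icc 1 m ×ˢ Finset.Icc 1 m) ×ˢ (Finset.Icc 1 m ×ˢ Finset.Icc 1 m)).filter
      (fun x => x.1.1 * x.1.2 * x.2.1 * x.2.2 = m),
    x.1.1 * fP P x.2.1 * fP P x.2.2

open scoped Classical in
/-- `Σ_{1 ≤ m < 2λ/β_P} h(m) · log(2λ/(m β_P))`. -/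
noncomputable def corrSum (P : Polynomial ℤ) (lam : ℝ) : ℝ :=
  ∑ m ∈ (Finset.Icc 1 (Nat.floor (2 * lam / betaP P))).filter
      (fun m : ℕ => (m : ℝ) < 2 * lam / betaP P),
    (hFun P m : ℝ) * Real.log (2 * lam / ((m : ℝ) * betaP P))


lemma pf_dvd_congr (P : Polynomial ℤ) (d : ℕ) (a b : ℤ) (h : (d : ℤ) ∣ a - b) :
    (d : ℤ) ∣ P.eval a ↔ (d : ℤ) ∣ P.eval b := by
  have h1 : (d : ℤ) ∣ P.eval a - P.eval b := h.trans (Polynomial.sub_dvd_eval_sub a b P)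
  exact (Int.dvd_iff_dvd_of_dvd_sub h1)

lemma pf_periodic (P : Polynomial ℤ) (d : ℕ) :
    Function.Periodic (fun a : ℕ => (d : ℤ) ∣ P.eval (a : ℤ)) d := by
  intro a
  exact propext (pf_dvd_congr P d _ _ (by push_cast; simp))

lemma pf_fP_count (P : Polynomial ℤ) (d : ℕ) :
    fP P d = d.count (fun a : ℕ => (d : ℤ) ∣ P.eval (a : ℤ)) := by
  rw [← Nat.filter_Ico_card_eq_of_periodic 1 d _ (pf_periodic P d), fP]
  congr 1
  ext x; simp; omega

lemma pf_count_mul (P : Polynomial ℤ) (d k : ℕ) :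
    (d * k).count (fun a : ℕ => (d : ℤ) ∣ P.eval (a : ℤ)) = k * fP P d := by
  induction k with
  | zero => simp
  | succ k ih =>
    rw [mul_add, mul_one, Nat.count_add, ih, add_mul, one_mul, pf_fP_count]
    congr 1
    simp only [Nat.count_eq_card_filter_range]
    congr 1
    ext x
    simp only [mem_filter, mem_range, and_congr_right_iff]
    intro _
    exact pf_dvd_congr P d _ _ (by push_cast; simp)

lemma pf_card_Icc_mul (P : Polynomial ℤ) (d k : ℕ) :
    ((Finset.Icc 1 (d * k)).filter (fun a : ℕ => (d : ℤ) ∣ P.eval (a : ℤ))).card = k * fP P d := by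
  have hper : Function.Periodic (fun a : ℕ => (d : ℤ) ∣ P.eval (a : ℤ)) (d * k) := by
    intro a
    exact propext (pf_dvd_congr P d _ _ (by push_cast; simp))
  rw [← pf_count_mul, ← Nat.filter_Ico_card_eq_of_periodic 1 (d * k) _ hper]
  congr 1
  ext x; simp; omega

lemma pf_fP_le (P : Polynomial ℤ) (d : ℕ) : fP P d ≤ d := by
  rw [fP]; exact (card_filter_le _ _).trans (by simp)

lemma pf_eval_zmod (P : Polynomial ℤ) (m : ℕ) (a : ℤ) :
    (P.map (Int.castRingHom (ZMod m))).eval (a : ZMod m) = 0 ↔ (m : ℤ) ∣ P.eval a := by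
  rw [← ZMod.intCast_zmod_eq_zero_iff_dvd]
  have : (P.map (Int.castRingHom (ZMod m))).eval ((Int.castRingHom (ZMod m)) a)
    = (Int.castRingHom (ZMod m)) (P.eval a) := Polynomial.eval_map_apply ..
  simp only [eq_intCast] at this
  rw [this]

lemma pf_fP_card (P : Polynomial ℤ) (m : ℕ) (hm : m ≠ 0) :
    fP P m = Nat.card {x : ZMod m // (P.map (Int.castRingHom (ZMod m))).eval x = 0} := by
  have : NeZero m := ⟨hm⟩
  rw [pf_fP_count, Nat.count_eq_card_filter_range, Nat.card_eq_fintype_card, Fintype.card_subtype]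
  refine Finset.card_bij (fun a _ => (a : ZMod m)) ?_ ?_ ?_
  · intro a ha
    simp only [mem_filter, mem_range, mem_univ, true_and] at ha ⊢
    exact_mod_cast (pf_eval_zmod P m a).2 ha.2
  · intro a ha b hb h
    simp only [mem_filter, mem_range] at ha hb
    have := (ZMod.natCast_eq_natCast_iff' a b m).1 h
    rwa [Nat.mod_eq_of_lt ha.1, Nat.mod_eq_of_lt hb.1] at this
  · intro b hb
    simp only [mem_filter, mem_univ, true_and] at hb
    refine ⟨b.val, ?_, by simp⟩
    simp only [mem_filter, mem_range]
    refine ⟨ZMod.val_lt b, (pf_eval_zmod P m _).1 ?_⟩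
    simpa using hb

lemma pf_fP_mul (P : Polynomial ℤ) (m n : ℕ) (hm : m ≠ 0) (hn : n ≠ 0) (h : m.Coprime n) :
    fP P (m * n) = fP P m * fP P n := by
  rw [pf_fP_card P m hm, pf_fP_card P n hn, pf_fP_card P _ (mul_ne_zero hm hn), ← Nat.card_prod]
  refine Nat.card_congr ?_
  let e := ZMod.chineseRemainder h
  refine Equiv.trans (e.toEquiv.subtypeEquiv
    (q := fun y => (P.map (Int.castRingHom (ZMod m))).eval y.1 = 0 ∧
      (P.map (Int.castRingHom (ZMod n))).eval y.2 = 0) ?_) (Equiv.subtypeProdEquivProd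
    (p := fun y => (P.map (Int.castRingHom (ZMod m))).eval y = 0)
    (q := fun y => (P.map (Int.castRingHom (ZMod n))).eval y = 0))
  intro x
  have h0 : (P.map (Int.castRingHom (ZMod (m * n)))).eval x = 0 ↔
      e ((P.map (Int.castRingHom (ZMod (m * n)))).eval x) = 0 := by simp
  have h1 : (e ((P.map (Int.castRingHom (ZMod (m * n)))).eval x)).1 =
     (P.map (Int.castRingHom (ZMod m))).eval (e x).1 := by
    have := Polynomial.eval_map_apply (p := P.map (Int.castRingHom (ZMod (m * n))))
      ((RingHom.fst (ZMod m) (ZMod n)).comp e.toRingHom) x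
    rw [Polynomial.map_map] at this
    rw [Subsingleton.elim (Int.castRingHom (ZMod m)) (((RingHom.fst (ZMod m) (ZMod n)).comp e.toRingHom).comp (Int.castRingHom (ZMod (m*n))))]
    exact this.symm
  have h2 : (e ((P.map (Int.castRingHom (ZMod (m * n)))).eval x)).2 =
     (P.map (Int.castRingHom (ZMod n))).eval (e x).2 := by
    have := Polynomial.eval_map_apply (p := P.map (Int.castRingHom (ZMod (m * n))))
      ((RingHom.snd (ZMod m) (ZMod n)).comp e.toRingHom) x
    rw [Polynomial.map_map] at this
    rw [Subsingleton.elim (Int.castRingHom (ZMod n)) (((RingHom.snd (ZMod m) (ZMod n)).comp e.toRingHom).comp (Int.castRingHom (ZMod (m*n))))]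
    exact this.symm
  rw [h0, Prod.ext_iff, h1, h2]
  rfl

lemma pf_fP_prime_le (P : Polynomial ℤ) (hP : P ≠ 0) (p : ℕ) (hp : p.Prime) :
    fP P p ≤ P.natDegree + P.leadingCoeff.natAbs := by
  have : Fact p.Prime := ⟨hp⟩
  by_cases h : (p : ℤ) ∣ P.leadingCoeff
  · have : p ≤ P.leadingCoeff.natAbs :=
      Nat.le_of_dvd (Int.natAbs_pos.2 (Polynomial.leadingCoeff_ne_zero.2 hP))
        (Int.natCast_dvd.1 h)
    have := pf_fP_le P p
    omega
  · have hne : P.map (Int.castRingHom (ZMod p)) ≠ 0 := by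
      intro h0
      have : (P.map (Int.castRingHom (ZMod p))).coeff P.natDegree = 0 := by rw [h0]; simp
      rw [Polynomial.coeff_map, eq_intCast, ZMod.intCast_zmod_eq_zero_iff_dvd] at this
      exact h this
    rw [pf_fP_card P p hp.ne_zero, Nat.card_eq_fintype_card, Fintype.card_subtype]
    calc _ ≤ (P.map (Int.castRingHom (ZMod p))).roots.toFinset.card := by
          apply card_le_card
          intro x hx
          simpa [hne] using hx
      _ ≤ _ := Multiset.toFinset_card_le _
      _ ≤ _ := Polynomial.card_roots' _
      _ ≤ P.natDegree := Polynomial.natDegree_map_le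
      _ ≤ _ := by omega

/-- The general term of the series. -/
noncomputable def pfG (P : Polynomial ℤ) (d : ℕ) : ℝ :=
  (ArithmeticFunction.moebius d : ℝ) * fP P d / (d : ℝ) ^ 2

lemma pf_fP_one (P : Polynomial ℤ) : fP P 1 = 1 := by simp [fP]

lemma pfG_zero (P : Polynomial ℤ) : pfG P 0 = 0 := by simp [pfG]
lemma pfG_one (P : Polynomial ℤ) : pfG P 1 = 1 := by simp [pfG, pf_fP_one]

lemma pfG_mul (P : Polynomial ℤ) {m n : ℕ} (h : m.Coprime n) :
    pfG P (m * n) = pfG P m * pfG P n := by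
  rcases eq_or_ne m 0 with rfl | hm
  · simp [pfG_zero]
  rcases eq_or_ne n 0 with rfl | hn
  · simp [pfG_zero]
  rw [pfG, pfG, pfG, pf_fP_mul P m n hm hn h,
    ArithmeticFunction.isMultiplicative_moebius.map_mul_of_coprime h]
  push_cast
  rw [mul_pow]
  field_simp

lemma pfG_prime (P : Polynomial ℤ) {p : ℕ} (hp : p.Prime) :
    pfG P p = - ((fP P p : ℝ) / (p : ℝ) ^ 2) := by
  simp [pfG, ArithmeticFunction.moebius_apply_prime hp, neg_div]

lemma pfG_pow (P : Polynomial ℤ) {p : ℕ} (hp : p.Prime) {e : ℕ} (he : e ∉ range 2) :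
    pfG P (p ^ e) = 0 := by
  simp only [mem_range, not_lt] at he
  have : ArithmeticFunction.moebius (p ^ e) = 0 := by
    rw [ArithmeticFunction.moebius_apply_prime_pow hp (by omega), if_neg (by omega)]
  simp [pfG, this]

lemma pf_summable_primes (P : Polynomial ℤ) (hP : P ≠ 0) :
    Summable (fun p : Nat.Primes => (fP P p : ℝ) / ((p : ℕ) : ℝ) ^ 2) := by
  have h2 : Summable (fun n : ℕ => ((P.natDegree + P.leadingCoeff.natAbs : ℕ) : ℝ) *
    (1 / (n : ℝ) ^ 2)) := (Real.summable_one_div_nat_pow.2 (by norm_num)).mul_left _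
  refine Summable.of_nonneg_of_le (fun p => by positivity) (fun p => ?_)
    (h2.comp_injective (Nat.Primes.coe_nat_injective))
  simp only [Function.comp]
  rw [mul_one_div]
  gcongr
  exact pf_fP_prime_le P hP p p.2

lemma pfG_summable (P : Polynomial ℤ) (hP : P ≠ 0) : Summable (fun d => ‖pfG P d‖) := by
  set f : ℕ → ℝ := fun d => ‖pfG P d‖ with hf
  have hf1 : f 1 = 1 := by simp [hf, pfG_one]
  have hmul : ∀ {m n}, Nat.Coprime m n → f (m * n) = f m * f n := by
    intro m n h; simp [hf, pfG_mul P h]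
  have hpow : ∀ {p : ℕ}, p.Prime → Summable (fun n : ℕ ↦ ‖f (p ^ n)‖) := by
    intro p hp
    apply summable_of_ne_finset_zero (s := range 2)
    intro e he
    simp [hf, pfG_pow P hp he]
  have ht : ∀ {p : ℕ}, p.Prime → ∑' n : ℕ, f (p ^ n) = 1 + (fP P p : ℝ) / (p : ℝ) ^ 2 := by
    intro p hp
    rw [tsum_eq_sum (s := range 2)]
    · rw [Finset.sum_range_succ, Finset.sum_range_one]
      simp only [hf, pow_zero, pow_one, pfG_one, pfG_prime P hp, norm_neg, norm_one]
      rw [Real.norm_of_nonneg (by positivity)]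
    · intro e he
      simp [hf, pfG_pow P hp he]
  refine summable_of_sum_range_le (c := Real.exp (∑' p : Nat.Primes, (fP P p : ℝ) / ((p : ℕ) : ℝ) ^ 2))
    (fun n => norm_nonneg _) (fun N => ?_)
  obtain ⟨h1, h2⟩ := EulerProduct.summable_and_hasSum_smoothNumbers_prod_primesBelow_tsum
    hf1 hmul hpow N
  have hle : ∑ i ∈ range N, f i ≤ ∏ p ∈ N.primesBelow, ∑' n : ℕ, f (p ^ n) := by
    rw [← h2.tsum_eq]
    have hs : Summable (fun m : N.smoothNumbers => f m) := h2.summable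
    rw [tsum_subtype (N.smoothNumbers) f]
    have hs' : Summable ((N.smoothNumbers).indicator f) := by
      rwa [← summable_subtype_iff_indicator]
    refine le_trans (le_of_eq ?_) (hs'.sum_le_tsum (range N) (fun i _ =>
      Set.indicator_nonneg (fun _ _ => norm_nonneg _) _))
    refine Finset.sum_congr rfl (fun i hi => ?_)
    rcases eq_or_ne i 0 with rfl | hi0
    · simp [hf, pfG_zero, Set.indicator]
    · rw [Set.indicator_of_mem]
      exact Nat.mem_smoothNumbers_of_lt (Nat.pos_of_ne_zero hi0) (mem_range.1 hi)
  refine hle.trans ?_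
  calc ∏ p ∈ N.primesBelow, ∑' n : ℕ, f (p ^ n)
      ≤ ∏ p ∈ N.primesBelow, Real.exp ((fP P p : ℝ) / (p : ℝ) ^ 2) := by
        apply Finset.prod_le_prod
        · intro p hp; exact tsum_nonneg (fun _ => norm_nonneg _)
        · intro p hp
          rw [ht (Nat.prime_of_mem_primesBelow hp), add_comm]
          exact Real.add_one_le_exp _
    _ = Real.exp (∑ p ∈ N.primesBelow, (fP P p : ℝ) / (p : ℝ) ^ 2) := (Real.exp_sum _ _).symm
    _ ≤ _ := by
        apply Real.exp_le_exp.2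
        have := pf_summable_primes P hP
        have h3 := (summable_subtype_iff_indicator (s := {p : ℕ | p.Prime}) (f := fun p : ℕ => (fP P p : ℝ) / (p : ℝ) ^ 2)).1 this
        have h4 : ∑' p : Nat.Primes, (fP P p : ℝ) / ((p : ℕ) : ℝ) ^ 2 = _ :=
          tsum_subtype {p : ℕ | p.Prime} (fun p : ℕ => (fP P p : ℝ) / (p : ℝ) ^ 2)
        rw [h4]
        refine le_trans (le_of_eq ?_) (h3.sum_le_tsum N.primesBelow (fun i _ =>
          Set.indicator_nonneg (fun _ _ => by positivity) _))
        refine Finset.sum_congr rfl (fun i hi => ?_)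
        rw [Set.indicator_of_mem]
        exact Nat.prime_of_mem_primesBelow hi

lemma pf_beta_eq (P : Polynomial ℤ) (hP : P ≠ 0) : betaP P = ∑' d, pfG P d := by
  have h := EulerProduct.eulerProduct_hasProd (pfG_one P) (fun h => pfG_mul P h)
    (pfG_summable P hP) (pfG_zero P)
  rw [← h.tprod_eq, betaP]
  refine tprod_congr (fun p => ?_)
  rw [tsum_eq_sum (s := range 2)]
  · rw [Finset.sum_range_succ, Finset.sum_range_one]
    simp only [pow_zero, pow_one, pfG_one, pfG_prime P p.2]
    ring
  · intro e he
    simp [pfG_pow P p.2 he]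

lemma pf_beta_pos (P : Polynomial ℤ) (hP : P ≠ 0) : 0 < betaP P := by
  have hs := (pf_summable_primes P hP)
  have hfac : ∀ p : Nat.Primes, 0 < 1 + (-((fP P p : ℝ) / ((p : ℕ) : ℝ) ^ 2)) := by
    intro p
    have h1 : (fP P p : ℝ) ≤ (p : ℕ) := by exact_mod_cast pf_fP_le P p
    have h2 : (1 : ℝ) < (p : ℕ) := by exact_mod_cast p.2.one_lt
    have : (fP P p : ℝ) / ((p : ℕ) : ℝ) ^ 2 < 1 := by
      rw [div_lt_one (by positivity)]
      nlinarith
    linarith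
  have hne := tprod_one_add_ne_zero_of_summable (fun p => (hfac p).ne')
    (by simpa using hs.norm)
  have heq : betaP P = ∏' p : Nat.Primes, (1 + (-((fP P p : ℝ) / ((p : ℕ) : ℝ) ^ 2))) := by
    rw [betaP]; exact tprod_congr (fun p => by ring)
  rw [← heq] at hne
  refine lt_of_le_of_ne ?_ hne.symm
  rw [heq]
  exact tprod_nonneg (fun p => (hfac p).le)

lemma pf_card_fareySet (P : Polynomial ℤ) (h0 : P.eval 0 = 0) (Q : ℕ) :
    (fareySet P Q).card = (fareyPairs P Q).card := by
  have hcop : ∀ a q : ℕ, Int.gcd (P.eval (a : ℤ)) (q : ℤ) = 1 → a.Coprime q := by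
    intro a q h
    have h1 : (a : ℤ) ∣ P.eval (a : ℤ) := by
      have := Polynomial.sub_dvd_eval_sub (a : ℤ) 0 P
      simpa [h0] using this
    have h2 : ((Nat.gcd a q : ℕ) : ℤ) ∣ (Int.gcd (P.eval (a : ℤ)) (q : ℤ) : ℤ) := by
      apply Int.dvd_coe_gcd
      · exact (Int.natCast_dvd_natCast.2 (Nat.gcd_dvd_left a q)).trans h1
      · exact (Int.natCast_dvd_natCast.2 (Nat.gcd_dvd_right a q))
    rw [h] at h2
    exact Nat.dvd_one.1 (Int.natCast_dvd_natCast.1 h2)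
  rw [fareySet]
  apply Finset.card_image_of_injOn
  rintro ⟨a, q⟩ hx ⟨b, r⟩ hy hxy
  simp only [fareyPairs, coe_filter, mem_product, mem_Icc, Set.mem_ofPred_eq] at hx hy hxy
  have c1 := hcop a q hx.2.2
  have c2 := hcop b r hy.2.2
  have hq : (q : ℚ) ≠ 0 := by have := hx.1.2.1; positivity
  have hr : (r : ℚ) ≠ 0 := by have := hy.1.2.1; positivity
  rw [div_eq_div_iff hq hr] at hxy
  have hxy' : a * r = b * q := by exact_mod_cast hxy
  have d1 : q ∣ r := c1.symm.dvd_of_dvd_mul_left (hxy' ▸ Dvd.intro_left b rfl)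
  have d2 : r ∣ q := c2.symm.dvd_of_dvd_mul_left (hxy' ▸ Dvd.intro_left a rfl)
  have e : q = r := Nat.dvd_antisymm d1 d2
  subst e
  have : a = b := Nat.eq_of_mul_eq_mul_right (by omega) hxy'
  rw [this]

lemma pf_inner_card (P : Polynomial ℤ) (Q d : ℕ) (hd : 1 ≤ d) :
    ((Finset.Icc 1 Q ×ˢ Finset.Icc 1 Q).filter
      (fun x : ℕ × ℕ => x.1 ≤ x.2 ∧ (d ∣ x.2 ∧ (d : ℤ) ∣ P.eval (x.1 : ℤ)))).card
      = fP P d * ∑ k ∈ Finset.Icc 1 (Q / d), k := by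
  have : fP P d * ∑ k ∈ Finset.Icc 1 (Q / d), k =
    ((Finset.Icc 1 (Q / d)).sigma (fun k => (Finset.Icc 1 (d * k)).filter
      (fun a : ℕ => (d : ℤ) ∣ P.eval (a : ℤ)))).card := by
    rw [card_sigma, mul_sum]
    exact Finset.sum_congr rfl (fun k _ => by rw [pf_card_Icc_mul, mul_comm])
  rw [this]
  symm
  refine Finset.card_bij (fun x _ => (x.2, d * x.1)) ?_ ?_ ?_
  · rintro ⟨k, a⟩ h
    simp only [mem_sigma, mem_Icc, mem_filter, mem_product] at h ⊢
    have h1 : d * k ≤ Q := (Nat.mul_le_mul_left d h.1.2).trans (Nat.mul_div_le Q d)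
    exact ⟨⟨⟨h.2.1.1, h.2.1.2.trans h1⟩, h.2.1.1.trans h.2.1.2, h1⟩, h.2.1.2, Dvd.intro k rfl, h.2.2⟩
  · rintro ⟨k, a⟩ h ⟨k', a'⟩ h' e
    simp only [Prod.mk.injEq] at e
    have : k = k' := Nat.eq_of_mul_eq_mul_left hd e.2
    rw [this, e.1]
  · rintro ⟨a, q⟩ h
    simp only [mem_Icc, mem_filter, mem_product] at h
    obtain ⟨⟨⟨h1, h2⟩, h3, h4⟩, h5, ⟨k, rfl⟩, h6⟩ := h
    refine ⟨⟨k, a⟩, ?_, rfl⟩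
    simp only [mem_sigma, mem_Icc, mem_filter]
    refine ⟨⟨?_, ?_⟩, ⟨h1, h5⟩, h6⟩
    · exact Nat.pos_of_mul_pos_left h3
    · rw [Nat.le_div_iff_mul_le hd, mul_comm]; exact h4

lemma pf_card_pairs (P : Polynomial ℤ) (Q : ℕ) :
    ((fareyPairs P Q).card : ℤ) = ∑ d ∈ Finset.Icc 1 Q, ArithmeticFunction.moebius d *
      ((fP P d * ∑ k ∈ Finset.Icc 1 (Q / d), k : ℕ) : ℤ) := by
  have key : ∀ n : ℕ, n ≠ 0 → ∑ d ∈ n.divisors, ArithmeticFunction.moebius d = if n = 1 then 1 else 0 := by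
    intro n hn
    rw [← ArithmeticFunction.coe_mul_zeta_apply, ArithmeticFunction.moebius_mul_coe_zeta,
      ArithmeticFunction.one_apply]
  have h1 : ∀ x ∈ (Finset.Icc 1 Q ×ˢ Finset.Icc 1 Q).filter (fun x : ℕ × ℕ => x.1 ≤ x.2),
     (if Int.gcd (P.eval (x.1 : ℤ)) (x.2 : ℤ) = 1 then (1 : ℤ) else 0) =
      ∑ d ∈ Finset.Icc 1 Q, if (d ∣ x.2 ∧ (d : ℤ) ∣ P.eval (x.1 : ℤ))
        then ArithmeticFunction.moebius d else 0 := by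
    rintro ⟨a, q⟩ hx
    simp only [mem_Icc, mem_filter, mem_product] at hx ⊢
    have hne : Int.gcd (P.eval (a : ℤ)) (q : ℤ) ≠ 0 := by
      intro h
      have := (Int.gcd_eq_zero_iff.1 h).2
      omega
    rw [← key _ hne, ← Finset.sum_filter]
    refine Finset.sum_congr ?_ (fun _ _ => rfl)
    ext d
    simp only [Nat.mem_divisors, mem_filter, mem_Icc]
    constructor
    · rintro ⟨h, _⟩
      have h2 : d ∣ q := by
        have : (d : ℤ) ∣ q := (Int.natCast_dvd_natCast.2 h).trans (Int.gcd_dvd_right ..)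
        exact_mod_cast this
      have h3 : (d : ℤ) ∣ P.eval (a : ℤ) := (Int.natCast_dvd_natCast.2 h).trans (Int.gcd_dvd_left ..)
      have := Nat.le_of_dvd (by omega) h2
      have := Nat.pos_of_dvd_of_pos h2 (by omega)
      exact ⟨by omega, h2, h3⟩
    · rintro ⟨_, h2, h3⟩
      refine ⟨?_, hne⟩
      exact_mod_cast Int.dvd_coe_gcd h3 (Int.natCast_dvd_natCast.2 h2)
  have h2 : ((fareyPairs P Q).card : ℤ) =
      ∑ x ∈ (Finset.Icc 1 Q ×ˢ Finset.Icc 1 Q).filter (fun x : ℕ × ℕ => x.1 ≤ x.2),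
        (if Int.gcd (P.eval (x.1 : ℤ)) (x.2 : ℤ) = 1 then (1 : ℤ) else 0) := by
    rw [fareyPairs, ← Finset.filter_filter, Finset.sum_boole]
  rw [h2, Finset.sum_congr rfl h1, Finset.sum_comm]
  refine Finset.sum_congr rfl (fun d hd => ?_)
  rw [← pf_inner_card P Q d (mem_Icc.1 hd).1, ← Finset.sum_filter, Finset.filter_filter,
    Finset.sum_const, nsmul_eq_mul, mul_comm]

lemma pf_gauss (K : ℕ) : ((∑ k ∈ Finset.Icc 1 K, k : ℕ) : ℝ) = (K : ℝ) * (K + 1) / 2 := by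
  induction K with
  | zero => simp
  | succ K ih => rw [Finset.sum_Icc_succ_top (by omega)]; push_cast at ih ⊢; rw [ih]; ring

lemma pf_density (P : Polynomial ℤ) (hP : P ≠ 0) (h0 : P.eval 0 = 0) :
    Tendsto (fun Q : ℕ => ((fareySet P Q).card : ℝ) / (Q : ℝ) ^ 2) atTop (nhds (betaP P / 2)) := by
  let F : ℕ → ℕ → ℝ := fun Q d => (ArithmeticFunction.moebius d : ℝ) * fP P d *
    (((Q / d : ℕ) : ℝ) * ((Q / d : ℕ) + 1) / 2) / (Q : ℝ) ^ 2
  have hF : ∀ Q : ℕ, ((fareySet P Q).card : ℝ) / (Q : ℝ) ^ 2 = ∑' d, F Q d := by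
    intro Q
    rw [tsum_eq_sum (s := Finset.Icc 1 Q)]
    · rw [pf_card_fareySet P h0]
      have := congrArg (fun z : ℤ => (z : ℝ)) (pf_card_pairs P Q)
      simp only [Int.cast_natCast, Int.cast_sum, Int.cast_mul] at this
      rw [this, Finset.sum_div]
      refine Finset.sum_congr rfl (fun d _ => ?_)
      rw [Nat.cast_mul, pf_gauss]
      simp only [F]; ring
    · intro d hd
      have : Q / d = 0 := by
        rw [Nat.div_eq_zero_iff]
        simp only [mem_Icc, not_and_or] at hd
        omega
      simp [F, this]
  simp_rw [hF]
  rw [pf_beta_eq P hP, ← tsum_div_const]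
  refine tendsto_tsum_of_dominated_convergence (bound := fun d => ‖pfG P d‖)
    (pfG_summable P hP) ?_ ?_
  · intro d
    rcases eq_or_ne d 0 with rfl | hd
    · simp [F, pfG]
    have hd' : (0 : ℝ) < d := by positivity
    have h1 : Tendsto (fun Q : ℕ => ((Q / d : ℕ) : ℝ) / (Q : ℝ)) atTop (nhds (1 / d)) := by
      have := (tendsto_nat_floor_mul_div_atTop (R := ℝ) (a := 1 / d) (by positivity)).comp
        (tendsto_natCast_atTop_atTop (R := ℝ))
      refine this.congr (fun Q => ?_)
      simp only [Function.comp]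
      rw [one_div_mul_eq_div, Nat.floor_div_eq_div]
    have h2 : Tendsto (fun Q : ℕ => 1 / (Q : ℝ)) atTop (nhds 0) := tendsto_one_div_atTop_nhds_zero_nat
    have h3 := ((h1.mul (h1.add h2)).div_const 2).const_mul
      ((ArithmeticFunction.moebius d : ℝ) * fP P d)
    have e : (ArithmeticFunction.moebius d : ℝ) * fP P d * (1 / (d : ℝ) * (1 / d + 0) / 2) = pfG P d / 2 := by
      rw [pfG]; field_simp; ring
    rw [e] at h3
    refine h3.congr' ?_
    filter_upwards [eventually_gt_atTop 0] with Q hQ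
    simp only [F]
    have : (Q : ℝ) ≠ 0 := by positivity
    field_simp
  · filter_upwards [eventually_gt_atTop 0] with Q hQ d
    rcases eq_or_ne d 0 with rfl | hd
    · simp [F]
    have hd' : (0 : ℝ) < d := by positivity
    have hQ' : (0 : ℝ) < Q := by positivity
    have hK : ((Q / d : ℕ) : ℝ) ≤ Q / d := Nat.cast_div_le
    have hK2 : ((Q / d : ℕ) : ℝ) * ((Q / d : ℕ) + 1) / 2 ≤ ((Q : ℝ) / d) ^ 2 := by
      have hn : ((Q / d : ℕ) : ℝ) ≤ ((Q / d : ℕ) : ℝ) ^ 2 := by exact_mod_cast Nat.le_self_pow two_ne_zero _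
      have : ((Q / d : ℕ) : ℝ) ^ 2 ≤ ((Q : ℝ) / d) ^ 2 := by gcongr
      nlinarith
    have e : F Q d = (ArithmeticFunction.moebius d : ℝ) * fP P d *
      ((((Q / d : ℕ) : ℝ) * ((Q / d : ℕ) + 1) / 2) / (Q : ℝ) ^ 2) := by simp only [F]; ring
    have e2 : pfG P d = (ArithmeticFunction.moebius d : ℝ) * fP P d * (1 / (d : ℝ) ^ 2) := by
      rw [pfG]; ring
    rw [e, e2, norm_mul _ (_ / _), norm_mul _ (1 / _)]
    gcongr
    rw [Real.norm_of_nonneg (by positivity), Real.norm_of_nonneg (by positivity),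
      div_le_div_iff₀ (by positivity) (by positivity)]
    calc _ ≤ ((Q : ℝ) / d) ^ 2 * (d : ℝ) ^ 2 := by gcongr
      _ = _ := by field_simp

/-- The area of the part of the unit square with `x * y > t`. -/
noncomputable def pfA (t : ℝ) : ℝ := 1 - min t 1 + min t 1 * Real.log (min t 1)

lemma pfA_continuous : Continuous pfA := by
  unfold pfA
  have h : Continuous (fun t : ℝ => min t 1) := by fun_prop
  have h2 : Continuous (fun t : ℝ => min t 1 * Real.log (min t 1)) :=
    Real.continuous_mul_log.comp h
  exact (continuous_const.sub h).add h2

lemma pfA_of_one_le {t : ℝ} (h : 1 ≤ t) : pfA t = 0 := by simp [pfA, min_eq_right h]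

lemma pf_log_bound {x y : ℝ} (hx : 0 < x) (hy : 0 < y) :
    Real.log y - Real.log x ≤ (y - x) / x := by
  rw [← Real.log_div hy.ne' hx.ne']
  have := Real.log_le_sub_one_of_pos (div_pos hy hx)
  rw [sub_div, div_self hx.ne']; exact this

lemma pf_sum_bound (R T : ℝ) (hR : 0 < R) (hT : 0 < T) (hTR : T ≤ R ^ 2) (n : ℕ) (hn : (n : ℝ) ≤ R) :
    ∑ u ∈ Finset.range n, max (R - T / ((u : ℝ) + 1)) 0 ≤
      R ^ 2 - T + T * Real.log (T / R ^ 2) + R := by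
  set x0 := T / R with hx0
  have hx0p : 0 < x0 := div_pos hT hR
  have hx0R : x0 ≤ R := by rw [hx0, div_le_iff₀ hR]; nlinarith
  let Φ : ℝ → ℝ := fun x => R * x - T * Real.log x
  let Ψ : ℝ → ℝ := fun x => Φ (max x x0)
  have hTx : T = R * x0 := by rw [hx0]; field_simp
  have hmono : ∀ x y : ℝ, x0 ≤ x → x ≤ y → Φ x ≤ Φ y := by
    intro x y h1 h2
    have hx : 0 < x := hx0p.trans_le h1
    have hy : 0 < y := hx.trans_le h2
    have h3 := mul_le_mul_of_nonneg_left (pf_log_bound hx hy) hT.le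
    have h4 : T * ((y - x) / x) ≤ R * (y - x) := by
      rw [← mul_div_assoc, div_le_iff₀ hx, hTx]
      have : 0 ≤ R * (y - x) := mul_nonneg hR.le (by linarith)
      nlinarith
    simp only [Φ]; nlinarith
  have hΨmono : ∀ x y : ℝ, x ≤ y → Ψ x ≤ Ψ y := fun x y h =>
    hmono _ _ (le_max_right _ _) (max_le_max_right _ h)
  have hstep : ∀ u : ℝ, 0 < u → max (R - T / u) 0 ≤ Ψ (u + 1) - Ψ u := by
    intro u hu
    apply max_le
    · by_cases h : x0 ≤ u
      · simp only [Ψ]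
        rw [max_eq_left h, max_eq_left (by linarith)]
        have h3 := mul_le_mul_of_nonneg_left (pf_log_bound hu (by linarith : 0 < u + 1)) hT.le
        simp only [Φ]
        have : T * ((u + 1 - u) / u) = T / u := by ring
        nlinarith
      · push Not at h
        have h1 := hΨmono u (u + 1) (by linarith)
        have : R ≤ T / u := by
          rw [le_div_iff₀ hu, hTx]; nlinarith
        linarith
    · have h1 := hΨmono u (u + 1) (by linarith)
      linarith
  have hsum : ∀ k : ℕ, ∑ u ∈ Finset.range k, max (R - T / ((u : ℝ) + 1)) 0 ≤ Ψ (k + 1) - Ψ 1 := by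
    intro k
    induction k with
    | zero => simp
    | succ k ih =>
      rw [Finset.sum_range_succ]
      have := hstep ((k : ℝ) + 1) (by positivity)
      push_cast
      linarith
  have hend : Φ R - Φ x0 = R ^ 2 - T + T * Real.log (T / R ^ 2) := by
    simp only [Φ]
    rw [hx0, Real.log_div hT.ne' hR.ne', Real.log_div hT.ne' (by positivity), Real.log_pow]
    field_simp
    push_cast; ring
  have hΨR : Ψ R = Φ R := by simp only [Ψ]; rw [max_eq_left hx0R]
  have hΨ1 : Φ x0 ≤ Ψ 1 := hmono _ _ le_rfl (le_max_right _ _)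
  rcases n with _ | k
  · have := hmono x0 R le_rfl hx0R
    simp only [Finset.range_zero, Finset.sum_empty]
    linarith
  · rw [Finset.sum_range_succ]
    push_cast at hn
    have h1 := hsum k
    have h2 := hΨmono _ _ hn
    have h3 : max (R - T / ((k : ℝ) + 1)) 0 ≤ R := max_le (by
      have : 0 < T / ((k : ℝ) + 1) := by positivity
      linarith) hR.le
    linarith

lemma pf_lattice (R T : ℝ) (hR : 0 < R) (hT : 0 < T) (n : ℕ) (hn : (n : ℝ) ≤ R) :
    ((((Finset.Icc 1 n ×ˢ Finset.Icc 1 n).filter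
      (fun x : ℕ × ℕ => T < (x.1 : ℝ) * x.2)).card : ℕ) : ℝ) ≤ R ^ 2 * pfA (T / R ^ 2) + 2 * R := by
  by_cases h : T ≤ R ^ 2
  · have hcard : ((Finset.Icc 1 n ×ˢ Finset.Icc 1 n).filter
      (fun x : ℕ × ℕ => T < (x.1 : ℝ) * x.2)).card =
      ∑ u ∈ Finset.range n, ((Finset.Icc 1 n).filter (fun v : ℕ => T < ((u : ℝ) + 1) * v)).card := by
      have hI : Finset.Icc 1 n = Finset.Ico (0 + 1) (n + 1) := by ext; simp
      rw [Finset.card_filter, Finset.sum_product]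
      nth_rewrite 1 [hI]
      rw [← Finset.sum_Ico_add', Finset.range_eq_Ico]
      refine Finset.sum_congr rfl (fun u _ => ?_)
      rw [Finset.card_filter]
      push_cast
      rfl
    rw [hcard]
    push_cast
    have hu : ∀ u ∈ Finset.range n,
      (((Finset.Icc 1 n).filter (fun v : ℕ => T < ((u : ℝ) + 1) * v)).card : ℝ) ≤
        max (R - T / ((u : ℝ) + 1)) 0 + 1 := by
      intro u _
      have hup : (0 : ℝ) < (u : ℝ) + 1 := by positivity
      have hsub : (Finset.Icc 1 n).filter (fun v : ℕ => T < ((u : ℝ) + 1) * v) ⊆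
          Finset.Ioc ⌊T / ((u : ℝ) + 1)⌋₊ n := by
        intro v hv
        simp only [mem_filter, mem_Icc, mem_Ioc] at hv ⊢
        refine ⟨?_, hv.1.2⟩
        rw [Nat.floor_lt (by positivity), div_lt_iff₀ hup, mul_comm]
        exact hv.2
      have h1 := Finset.card_le_card hsub
      rw [Nat.card_Ioc] at h1
      have h2 : (((Finset.Icc 1 n).filter (fun v : ℕ => T < ((u : ℝ) + 1) * v)).card : ℝ) ≤
        ((n - ⌊T / ((u : ℝ) + 1)⌋₊ : ℕ) : ℝ) := by exact_mod_cast h1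
      refine h2.trans ?_
      rcases le_total ⌊T / ((u : ℝ) + 1)⌋₊ n with h3 | h3
      · rw [Nat.cast_sub h3]
        have h4 := Nat.lt_floor_add_one (T / ((u : ℝ) + 1))
        have h5 := le_max_left (R - T / ((u : ℝ) + 1)) 0
        linarith
      · rw [Nat.sub_eq_zero_of_le h3]
        have h5 := le_max_right (R - T / ((u : ℝ) + 1)) 0
        push_cast; linarith
    refine (Finset.sum_le_sum hu).trans ?_
    rw [Finset.sum_add_distrib, Finset.sum_const, card_range, nsmul_eq_mul, mul_one]
    have h6 := pf_sum_bound R T hR hT h n hn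
    have h7 : R ^ 2 * pfA (T / R ^ 2) = R ^ 2 - T + T * Real.log (T / R ^ 2) := by
      rw [pfA, min_eq_left ((div_le_one (by positivity)).2 h)]
      field_simp
    linarith
  · push Not at h
    rw [Finset.filter_false_of_mem, pfA_of_one_le]
    · simp; exact hR.le
    · rw [le_div_iff₀ (by positivity)]; linarith
    · intro x hx
      simp only [mem_product, mem_Icc] at hx
      have h1 : (x.1 : ℝ) ≤ R := le_trans (by exact_mod_cast hx.1.2) hn
      have h2 : (x.2 : ℝ) ≤ R := le_trans (by exact_mod_cast hx.2.2) hn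
      have h3 : (x.1 : ℝ) * x.2 ≤ R * R := by gcongr
      nlinarith

lemma pf_uniq (q r g u v : ℕ) (hg : 0 < g) (hu : 0 < u) (hv : 0 < v) (hq : q = g * u)
    (hr : r = g * v) (huv : u.Coprime v) (a a' b b' k k' : ℤ)
    (ha : 0 < a) (ha' : 0 < a') (hb : 0 < b) (hb' : 0 < b') (hbr : b ≤ r) (hbr' : b' ≤ r)
    (hm : a * r - b * q - k * q * r = a' * r - b' * q - k' * q * r)
    (hj : (a - 1) / u = (a' - 1) / u) : a = a' ∧ b = b' := by
  subst hq hr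
  push_cast at *
  have hg' : (g : ℤ) ≠ 0 := by positivity
  have hu' : (u : ℤ) ≠ 0 := by positivity
  have h1 : (a - a') * v = u * ((b - b') + (k - k') * g * v) := by
    apply mul_left_cancel₀ hg'
    linear_combination hm
  have h2 : (u : ℤ) ∣ a - a' :=
    (Nat.isCoprime_iff_coprime.2 huv).dvd_of_dvd_mul_right (Dvd.intro _ h1.symm)
  have h3 : a = a' := by
    have e1 := Int.emod_add_mul_ediv (a - 1) u
    have e2 := Int.emod_add_mul_ediv (a' - 1) u
    have e3 : (a - 1) % u = (a' - 1) % u := by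
      apply Int.ModEq.symm
      apply Int.modEq_of_dvd
      simpa using h2
    rw [hj, e3] at e1
    linarith
  refine ⟨h3, ?_⟩
  subst h3
  have h4 : (b - b') + (k - k') * g * v = 0 := by
    have : (u : ℤ) * ((b - b') + (k - k') * g * v) = 0 := by rw [← h1]; ring
    exact (mul_eq_zero.1 this).resolve_left hu'
  have h5 : ((g : ℤ) * v) ∣ b - b' := ⟨-(k - k'), by linear_combination h4⟩
  have h6 : |b - b'| < (g : ℤ) * v := by rw [abs_lt]; constructor <;> linarith
  have := Int.eq_zero_of_abs_lt_dvd h5 h6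
  linarith

open scoped Classical in
lemma pf_pair_count (F : Finset ℚ) (Q M : ℕ) (Λ : ℝ) (hΛ : 0 < Λ)
    (hF : ∀ x ∈ F, 0 < x ∧ x ≤ 1 ∧ x.den ≤ Q) (hN : 0 < F.card)
    (hM : Λ * (Q : ℝ) ^ 2 / F.card < M + 1) :
    ((F ×ˢ F).filter (fun x => x.1 ≠ x.2 ∧
      ∃ k : ℤ, ((x.1 : ℝ) - (x.2 : ℝ) - (k : ℝ)) * (F.card : ℝ) ∈ Set.Ioo 0 Λ)).card ≤
    ∑ m ∈ Finset.Icc 1 M, ∑ g ∈ m.divisors, g *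
      ((Finset.Icc 1 (Q / g) ×ˢ Finset.Icc 1 (Q / g)).filter
      (fun x : ℕ × ℕ => (m : ℝ) * F.card / (Λ * (g : ℝ) ^ 2) < (x.1 : ℝ) * x.2)).card := by
  have hN' : (0 : ℝ) < F.card := by positivity
  set t := (Finset.Icc 1 M).sigma (fun m => m.divisors.sigma (fun g => Finset.range g ×ˢ
      ((Finset.Icc 1 (Q / g) ×ˢ Finset.Icc 1 (Q / g)).filter
      (fun x : ℕ × ℕ => (m : ℝ) * F.card / (Λ * (g : ℝ) ^ 2) < (x.1 : ℝ) * x.2)))) with ht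
  have htc : t.card = ∑ m ∈ Finset.Icc 1 M, ∑ g ∈ m.divisors, g *
      ((Finset.Icc 1 (Q / g) ×ˢ Finset.Icc 1 (Q / g)).filter
      (fun x : ℕ × ℕ => (m : ℝ) * F.card / (Λ * (g : ℝ) ^ 2) < (x.1 : ℝ) * x.2)).card := by
    rw [ht, card_sigma]
    refine Finset.sum_congr rfl (fun m _ => ?_)
    rw [card_sigma]
    refine Finset.sum_congr rfl (fun g _ => ?_)
    rw [card_product, card_range]
  rw [← htc]
  refine Finset.card_le_card_of_forall_subsingleton
    (fun (x : ℚ × ℚ) (z : (_ : ℕ) × (_ : ℕ) × ℕ × (ℕ × ℕ)) =>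
      x.1.den = z.2.1 * z.2.2.2.1 ∧ x.2.den = z.2.1 * z.2.2.2.2 ∧
      z.2.2.2.1.Coprime z.2.2.2.2 ∧
      ((z.2.2.1 : ℕ) : ℤ) = (x.1.num - 1) / (z.2.2.2.1 : ℕ) ∧
      ∃ k : ℤ, ((z.1 : ℕ) : ℤ) = x.1.num * x.2.den - x.2.num * x.1.den - k * x.1.den * x.2.den) ?_ ?_
  · rintro ⟨x, y⟩ hxy
    simp only [mem_filter, mem_product, Set.mem_Ioo] at hxy
    obtain ⟨⟨hx, hy⟩, hne, k, hk0, hk1⟩ := hxy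
    obtain ⟨hx0, hx1, hxQ⟩ := hF x hx
    obtain ⟨hy0, hy1, hyQ⟩ := hF y hy
    set q := x.den with hq
    set r := y.den with hr
    have hqp : 0 < q := x.den_pos
    have hrp : 0 < r := y.den_pos
    set g := Nat.gcd q r with hg
    have hgp : 0 < g := Nat.gcd_pos_of_pos_left _ hqp
    obtain ⟨u, hu⟩ : g ∣ q := Nat.gcd_dvd_left _ _
    obtain ⟨v, hv⟩ : g ∣ r := Nat.gcd_dvd_right _ _
    have hup : 0 < u := Nat.pos_of_ne_zero (by rintro rfl; simp at hu; omega)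
    have hvp : 0 < v := Nat.pos_of_ne_zero (by rintro rfl; simp at hv; omega)
    have hcop : u.Coprime v := by
      have h1 : g * Nat.gcd u v = g * 1 := by
        rw [← Nat.gcd_mul_left, ← hu, ← hv, mul_one]
      exact Nat.eq_of_mul_eq_mul_left hgp h1
    have hxv : (x : ℝ) = x.num / (q : ℝ) := by rw [hq]; exact_mod_cast (Rat.num_div_den x).symm
    have hyv : (y : ℝ) = y.num / (r : ℝ) := by rw [hr]; exact_mod_cast (Rat.num_div_den y).symm
    have hqR : (0 : ℝ) < q := by positivity
    have hrR : (0 : ℝ) < r := by positivity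
    set mz : ℤ := x.num * r - y.num * q - k * q * r with hmz
    have hmzR : (mz : ℝ) = ((x : ℝ) - y - k) * (q * r) := by
      rw [hmz, hxv, hyv]; push_cast; field_simp
    have hdiff : 0 < (x : ℝ) - y - k := pos_of_mul_pos_left hk0 hN'.le
    have hmpos : 0 < mz := by
      have : (0 : ℝ) < mz := by rw [hmzR]; positivity
      exact_mod_cast this
    obtain ⟨m, hm⟩ : ∃ m : ℕ, (m : ℤ) = mz := ⟨mz.toNat, Int.toNat_of_nonneg hmpos.le⟩
    have hmR : (m : ℝ) = ((x : ℝ) - y - k) * (q * r) := by rw [← hmzR, ← hm]; simp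
    have hlt : (m : ℝ) * F.card < Λ * (q * r) := by
      rw [hmR]
      calc _ = (((x : ℝ) - y - k) * F.card) * (q * r) := by ring
        _ < _ := by gcongr
    have hnum0 : 0 < x.num := Rat.num_pos.2 hx0
    have hnumq : x.num ≤ q := by
      have := Rat.le_iff x 1
      simp only [Rat.num_one, Rat.den_one] at this
      simpa using this.1 hx1
    have hgm : g ∣ m := by
      have h1 : (g : ℤ) ∣ mz := by
        rw [hmz, hu, hv]; push_cast
        exact ⟨x.num * v - y.num * u - k * u * (g * v), by ring⟩
      rw [← hm] at h1
      exact_mod_cast h1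
    have hm1 : 1 ≤ m := by omega
    refine ⟨⟨m, g, ((x.num - 1) / u).toNat, u, v⟩, ?_, hu, hv, hcop, ?_, k, hm⟩
    · simp only [ht, mem_sigma, mem_Icc, Nat.mem_divisors, mem_product, mem_range, mem_filter]
      refine ⟨⟨hm1, ?_⟩, ⟨hgm, by omega⟩, ?_, ⟨⟨hup, ?_⟩, hvp, ?_⟩, ?_⟩
      · have h1 : (m : ℝ) < Λ * (Q : ℝ) ^ 2 / F.card := by
          rw [lt_div_iff₀ hN']
          refine hlt.trans_le ?_
          have h2 : (q : ℝ) ≤ Q := by exact_mod_cast hxQ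
          have h3 : (r : ℝ) ≤ Q := by exact_mod_cast hyQ
          rw [pow_two]
          gcongr
        have h2 : (m : ℝ) < (M + 1 : ℕ) := by push_cast; linarith
        have : m < M + 1 := by exact_mod_cast h2
        omega
      · have h1 : (x.num - 1) / (u : ℤ) < g := by
          apply Int.ediv_lt_of_lt_mul (by positivity)
          have : (q : ℤ) = g * u := by exact_mod_cast hu
          linarith
        omega
      · rw [Nat.le_div_iff_mul_le hgp, mul_comm, ← hu]; exact hxQ
      · rw [Nat.le_div_iff_mul_le hgp, mul_comm, ← hv]; exact hyQ
      · rw [div_lt_iff₀ (by positivity)]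
        refine hlt.trans_le (le_of_eq ?_)
        rw [hu, hv]; push_cast; ring
    · simp only
      rw [Int.toNat_of_nonneg]
      exact Int.ediv_nonneg (by omega) (by positivity)
  · rintro ⟨m, g, j, u, v⟩ hz ⟨x, y⟩ ⟨hxs, hx1, hx2, hx3, hx4, k, hx5⟩ ⟨x', y'⟩ ⟨hxs', hx1', hx2', hx3', hx4', k', hx5'⟩
    simp only [mem_filter, mem_product] at *
    obtain ⟨hx0, hxl, _⟩ := hF x hxs.1.1
    obtain ⟨hy0, hyl, _⟩ := hF y hxs.1.2
    obtain ⟨hx0', hxl', _⟩ := hF x' hxs'.1.1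
    obtain ⟨hy0', hyl', _⟩ := hF y' hxs'.1.2
    have hden1 : x.den = x'.den := by rw [hx1, hx1']
    have hden2 : y.den = y'.den := by rw [hx2, hx2']
    have hp1 := x.den_pos
    have hp2 := y.den_pos
    rw [hx1] at hp1
    rw [hx2] at hp2
    have hgp := Nat.pos_of_mul_pos_right hp1
    have hup := Nat.pos_of_mul_pos_left hp1
    have hvp := Nat.pos_of_mul_pos_left hp2
    have hle : ∀ w : ℚ, w ≤ 1 → w.num ≤ w.den := by
      intro w hw
      have := Rat.le_iff w 1
      simp only [Rat.num_one, Rat.den_one] at this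
      simpa using this.1 hw
    have := pf_uniq x.den y.den g u v hgp hup hvp hx1 hx2 hx3 x.num x'.num y.num y'.num k k'
      (Rat.num_pos.2 hx0) (Rat.num_pos.2 hx0') (Rat.num_pos.2 hy0) (Rat.num_pos.2 hy0')
      (hle y hyl) (by rw [hden2]; exact hle y' hyl')
      (by rw [← hx5, hx5', hden1, hden2]) (by rw [← hx4, ← hx4'])
    have e1 : x = x' := Rat.ext this.1 hden1
    have e2 : y = y' := Rat.ext this.2 hden2
    rw [e1, e2]

lemma pf_fareySet_mem (P : Polynomial ℤ) (Q : ℕ) : ∀ x ∈ fareySet P Q,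
    0 < x ∧ x ≤ 1 ∧ x.den ≤ Q := by
  intro x hx
  simp only [fareySet, fareyPairs, mem_image, mem_filter, mem_product, mem_Icc] at hx
  obtain ⟨⟨a, q⟩, ⟨⟨⟨h1, h2⟩, h3, h4⟩, h5, _⟩, rfl⟩ := hx
  simp only at *
  have hq : (0 : ℚ) < q := by positivity
  refine ⟨by positivity, ?_, ?_⟩
  · rw [div_le_one hq]; exact_mod_cast h5
  · have := Rat.den_dvd (a : ℤ) (q : ℤ)
    rw [Rat.divInt_eq_div, Int.cast_natCast, Int.cast_natCast] at this
    have h6 : (((a : ℚ) / q).den) ∣ q := Int.natCast_dvd_natCast.1 this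
    exact (Nat.le_of_dvd (by omega) h6).trans h4

lemma pfA_nonneg {t : ℝ} (ht : 0 < t) : 0 ≤ pfA t := by
  unfold pfA
  set s := min t 1
  have hs : 0 < s := lt_min ht one_pos
  have h := mul_le_mul_of_nonneg_left (Real.one_sub_inv_le_log_of_pos hs) hs.le
  rw [mul_sub, mul_inv_cancel₀ hs.ne'] at h
  linarith

lemma pf_zero_on {b x : ℝ} (hb : 0 < b) (hx : 0 ≤ x) (hxb : x ≤ b) :
    (1 / x ^ 2) * max (Real.log (x / b)) 0 = 0 := by
  rw [max_eq_right, mul_zero]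
  exact Real.log_nonpos (by positivity) ((div_le_one hb).2 hxb)

lemma pf_integral (b Λ : ℝ) (hb : 0 < b) (hΛ : 0 < Λ) :
    IntervalIntegrable (fun x : ℝ => (1 / x ^ 2) * max (Real.log (x / b)) 0)
      MeasureTheory.volume 0 Λ ∧
    ∫ x in (0 : ℝ)..Λ, (1 / x ^ 2) * max (Real.log (x / b)) 0 = (1 / b) * pfA (b / Λ) := by
  have hzero : ∀ c : ℝ, 0 < c → c ≤ b →
      IntervalIntegrable (fun x : ℝ => (1 / x ^ 2) * max (Real.log (x / b)) 0)
        MeasureTheory.volume 0 c ∧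
      ∫ x in (0 : ℝ)..c, (1 / x ^ 2) * max (Real.log (x / b)) 0 = 0 := by
    intro c hc hcb
    have hz : ∀ x ∈ Set.uIcc (0 : ℝ) c, (0 : ℝ) = (1 / x ^ 2) * max (Real.log (x / b)) 0 := by
      intro x hx
      rw [Set.uIcc_of_le hc.le] at hx
      exact (pf_zero_on hb hx.1 (hx.2.trans hcb)).symm
    constructor
    · exact (intervalIntegrable_const (c := (0 : ℝ))).congr
        (fun x hx => hz x (Set.uIoc_subset_uIcc hx))
    · rw [← intervalIntegral.integral_congr hz]; simp
  rcases le_or_gt Λ b with h | h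
  · obtain ⟨h1, h2⟩ := hzero Λ hΛ h
    refine ⟨h1, ?_⟩
    rw [h2, pfA_of_one_le ((one_le_div hΛ).2 h), mul_zero]
  · obtain ⟨h1, h2⟩ := hzero b hb le_rfl
    have hcont : ContinuousOn (fun x : ℝ => (1 / x ^ 2) * max (Real.log (x / b)) 0)
        (Set.uIcc b Λ) := by
      rw [Set.uIcc_of_le h.le]
      intro x hx
      have hx0 : 0 < x := hb.trans_le hx.1
      apply ContinuousAt.continuousWithinAt
      have : x / b ≠ 0 := by positivity
      have : x ^ 2 ≠ 0 := by positivity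
      have hl : ContinuousAt (fun x : ℝ => Real.log (x / b)) x :=
        ContinuousAt.log (by fun_prop) (by assumption)
      have hl2 : ContinuousAt (fun x : ℝ => max (Real.log (x / b)) 0) x :=
        hl.max continuousAt_const
      have hl3 : ContinuousAt (fun x : ℝ => 1 / x ^ 2) x :=
        continuousAt_const.div (by fun_prop) (by assumption)
      exact hl3.mul hl2
    have hint := hcont.intervalIntegrable (μ := MeasureTheory.volume)
    refine ⟨h1.trans hint, ?_⟩
    rw [← intervalIntegral.integral_add_adjacent_intervals h1 hint, h2, zero_add]
    have hder : ∀ x ∈ Set.uIcc b Λ, HasDerivAt (fun x : ℝ => -(Real.log (x / b) + 1) / x)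
        ((1 / x ^ 2) * max (Real.log (x / b)) 0) x := by
      rw [Set.uIcc_of_le h.le]
      intro x hx
      have hx0 : 0 < x := hb.trans_le hx.1
      have hl : HasDerivAt (fun x : ℝ => Real.log (x / b)) (1 / b / (x / b)) x :=
        ((hasDerivAt_id x).div_const b).log (by simp; constructor <;> positivity)
      have hd := ((hl.add_const 1).neg).div (hasDerivAt_id x) hx0.ne'
      refine hd.congr_deriv ?_
      rw [max_eq_left (Real.log_nonneg ((one_le_div hb).2 hx.1))]
      simp only [id, Pi.neg_apply]
      field_simp
      ring
    rw [intervalIntegral.integral_eq_sub_of_hasDerivAt hder hint, pfA,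
      min_eq_left ((div_le_one hΛ).2 h.le), div_self hb.ne', Real.log_one,
      Real.log_div hΛ.ne' hb.ne', Real.log_div hb.ne' hΛ.ne']
    field_simp
    ring

lemma pf_corrSum_integral (P : Polynomial ℤ) (hβ : 0 < betaP P) (Λ : ℝ) (hΛ : 0 < Λ) (M : ℕ)
    (hM : 2 * Λ / betaP P ≤ M) :
    ∫ lam in (0 : ℝ)..Λ, (1 / lam ^ 2) * corrSum P lam =
      ∑ m ∈ Finset.Icc 1 M, (hFun P m : ℝ) *
        ((1 / (m * betaP P / 2)) * pfA ((m * betaP P / 2) / Λ)) := by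
  have hpt : ∀ x ∈ Set.uIcc (0 : ℝ) Λ, (1 / x ^ 2) * corrSum P x =
      ∑ m ∈ Finset.Icc 1 M, (hFun P m : ℝ) *
        ((1 / x ^ 2) * max (Real.log (x / (m * betaP P / 2))) 0) := by
    intro x hx
    rw [Set.uIcc_of_le hΛ.le] at hx
    rw [corrSum, Finset.mul_sum]
    have hsub : (Finset.Icc 1 (Nat.floor (2 * x / betaP P))).filter
      (fun m : ℕ => (m : ℝ) < 2 * x / betaP P) ⊆ Finset.Icc 1 M := by
      intro m hm
      simp only [mem_filter, mem_Icc] at hm ⊢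
      refine ⟨hm.1.1, ?_⟩
      have h1 : 2 * x / betaP P ≤ 2 * Λ / betaP P := by gcongr; exact hx.2
      have : (m : ℝ) ≤ M := by linarith [hm.2]
      exact_mod_cast this
    rw [← Finset.sum_subset hsub]
    · refine Finset.sum_congr (by congr) (fun m hm => ?_)
      simp only [mem_filter, mem_Icc] at hm
      have hm0 : (0 : ℝ) < m := by have := hm.1.1; positivity
      have e : x / (m * betaP P / 2) = 2 * x / (m * betaP P) := by field_simp
      have h1 : 1 ≤ 2 * x / (m * betaP P) := by
        rw [le_div_iff₀ (by positivity)]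
        have := (lt_div_iff₀ hβ).1 hm.2
        linarith
      rw [e, max_eq_left (Real.log_nonneg h1)]
      ring
    · intro m hm hm'
      simp only [mem_filter, mem_Icc] at hm hm'
      have hm0 : (0 : ℝ) < m := by have := hm.1; positivity
      have h1 : 2 * x / betaP P ≤ m := by
        by_contra hc
        push Not at hc
        exact hm' ⟨⟨hm.1, Nat.le_floor hc.le⟩, hc⟩
      rw [pf_zero_on (by positivity) hx.1, mul_zero]
      rw [div_le_iff₀ hβ] at h1
      linarith
  rw [intervalIntegral.integral_congr hpt, intervalIntegral.integral_finsetSum]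
  · refine Finset.sum_congr rfl (fun m hm => ?_)
    have hm0 : (0 : ℝ) < m := by have := (mem_Icc.1 hm).1; positivity
    rw [intervalIntegral.integral_const_mul, (pf_integral _ Λ (by positivity) hΛ).2]
  · intro m hm
    have hm0 : (0 : ℝ) < m := by have := (mem_Icc.1 hm).1; positivity
    exact (pf_integral _ Λ (by positivity) hΛ).1.const_mul _

lemma pf_hFun (P : Polynomial ℤ) (m : ℕ) (hm : 1 ≤ m) :
    ∑ g ∈ m.divisors, (g : ℝ) * (1 / (g : ℝ) ^ 2) ≤ (hFun P m : ℝ) / m := by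
  have h1 : ∑ g ∈ m.divisors, m / g ≤ hFun P m := by
    have hinj : Set.InjOn (fun g : ℕ => (((m / g, g), (1, 1)) : (ℕ × ℕ) × (ℕ × ℕ))) m.divisors := by
      intro a _ b _ h
      simp only [Prod.mk.injEq] at h
      exact h.1.2
    have e : ∑ g ∈ m.divisors, m / g =
      ∑ x ∈ m.divisors.image (fun g : ℕ => (((m / g, g), (1, 1)) : (ℕ × ℕ) × (ℕ × ℕ))),
        x.1.1 * fP P x.2.1 * fP P x.2.2 := by
      rw [Finset.sum_image hinj]
      simp [pf_fP_one]
    rw [e, hFun]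
    apply Finset.sum_le_sum_of_subset
    intro x hx
    simp only [mem_image, Nat.mem_divisors] at hx
    obtain ⟨g, ⟨hg, _⟩, rfl⟩ := hx
    have hgp : 0 < g := Nat.pos_of_dvd_of_pos hg hm
    simp only [mem_filter, mem_product, mem_Icc, mul_one]
    have := Nat.div_mul_cancel hg
    refine ⟨⟨⟨⟨Nat.div_pos (Nat.le_of_dvd hm hg) hgp, Nat.div_le_self _ _⟩, hgp, Nat.le_of_dvd hm hg⟩, ⟨le_rfl, hm⟩, le_rfl, hm⟩, this⟩
  have hm0 : (0 : ℝ) < m := by positivity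
  have h2 : ((∑ g ∈ m.divisors, m / g : ℕ) : ℝ) ≤ hFun P m := by exact_mod_cast h1
  rw [le_div_iff₀ hm0, Finset.sum_mul]
  refine le_trans (le_of_eq ?_) h2
  rw [Nat.cast_sum]
  refine Finset.sum_congr rfl (fun g hg => ?_)
  have hg' := Nat.dvd_of_mem_divisors hg
  have hgp : 0 < g := Nat.pos_of_dvd_of_pos hg' hm
  rw [Nat.cast_div hg' (by positivity)]
  field_simp

/-- Upper bound for the pair correlation. -/
noncomputable def pfU (M : ℕ) (Λ ρ ε : ℝ) : ℝ :=
  (1 / ρ) * ∑ m ∈ Finset.Icc 1 M, ∑ g ∈ m.divisors, (g : ℝ) *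
    ((1 / (g : ℝ) ^ 2) * pfA (m * ρ / Λ) + 2 / g * ε)

lemma pf_le_U (P : Polynomial ℤ) (Q M : ℕ) (hQ : 0 < Q) (Λ : ℝ) (hΛ : 0 < Λ)
    (hN : 0 < (fareySet P Q).card) (hM : Λ * (Q : ℝ) ^ 2 / (fareySet P Q).card < M + 1) :
    pairCorr (fareySet P Q) Λ ≤
      pfU M Λ (((fareySet P Q).card : ℝ) / (Q : ℝ) ^ 2) (1 / (Q : ℝ)) := by
  have hN' : (0 : ℝ) < (fareySet P Q).card := by positivity
  have hQ' : (0 : ℝ) < Q := by positivity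
  rw [pairCorr, pfU]
  have h1 := pf_pair_count (fareySet P Q) Q M Λ hΛ (pf_fareySet_mem P Q) hN hM
  have h2 := (Nat.cast_le (α := ℝ)).2 h1
  rw [div_le_iff₀ hN']
  refine le_trans h2 ?_
  push_cast
  rw [Finset.mul_sum, Finset.sum_mul]
  refine Finset.sum_le_sum (fun m hm => ?_)
  rw [Finset.mul_sum, Finset.sum_mul]
  refine Finset.sum_le_sum (fun g hg => ?_)
  have hm0 : (0 : ℝ) < m := by have := (mem_Icc.1 hm).1; positivity
  have hgp : 0 < g := Nat.pos_of_mem_divisors hg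
  have hg0 : (0 : ℝ) < g := by positivity
  have h3 := pf_lattice ((Q : ℝ) / g) ((m : ℝ) * (fareySet P Q).card / (Λ * (g : ℝ) ^ 2))
    (by positivity) (by positivity) (Q / g) Nat.cast_div_le
  have e : (m : ℝ) * (fareySet P Q).card / (Λ * (g : ℝ) ^ 2) / ((Q : ℝ) / g) ^ 2 =
    m * (((fareySet P Q).card : ℝ) / (Q : ℝ) ^ 2) / Λ := by field_simp
  rw [e] at h3
  refine (mul_le_mul_of_nonneg_left h3 hg0.le).trans (le_of_eq ?_)
  generalize pfA (m * (((fareySet P Q).card : ℝ) / (Q : ℝ) ^ 2) / Λ) = z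
  field_simp

theorem limsup_pairCorr_polyFarey (ν : ℕ) (hν : 2 ≤ ν) (c : ℕ → ℤ) (hc : c ν ≠ 0)
    (P : Polynomial ℤ)
    (hP : P = ∑ i ∈ Finset.Icc 1 ν, Polynomial.C (c i) * Polynomial.X ^ i)
    (hdisc : (P.map (Int.castRingHom ℚ)).Separable) :
    ∃ C : ℝ, 0 < C ∧ ∀ Λ : ℝ, 0 < Λ →
      (IsBoundedUnder (· ≤ ·) atTop (fun Q : ℕ => pairCorr (fareySet P Q) Λ)) ∧
      Filter.limsup (fun Q : ℕ => pairCorr (fareySet P Q) Λ) atTop ≤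
        C * ∫ lam in (0 : ℝ)..Λ, (1 / lam ^ 2) * corrSum P lam := by
  have hP0 : P ≠ 0 := by
    rintro h
    rw [h] at hdisc
    simp [Polynomial.not_separable_zero] at hdisc
  have h0 : P.eval 0 = 0 := by
    rw [hP, Polynomial.eval_finsetSum]
    refine Finset.sum_eq_zero (fun i hi => ?_)
    have : i ≠ 0 := by have := (mem_Icc.1 hi).1; omega
    simp [this]
  have hβ := pf_beta_pos P hP0
  have hden := pf_density P hP0 h0
  refine ⟨1, one_pos, fun Λ hΛ => ?_⟩
  set M : ℕ := ⌊2 * Λ / betaP P⌋₊ + 1 with hMdef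
  have hM : 2 * Λ / betaP P < M := by
    rw [hMdef]; push_cast; exact Nat.lt_floor_add_one _
  have hev : ∀ᶠ Q : ℕ in atTop, pairCorr (fareySet P Q) Λ ≤
      pfU M Λ (((fareySet P Q).card : ℝ) / (Q : ℝ) ^ 2) (1 / (Q : ℝ)) := by
    have hlim : Tendsto (fun Q : ℕ => Λ / (((fareySet P Q).card : ℝ) / (Q : ℝ) ^ 2)) atTop
        (nhds (Λ / (betaP P / 2))) := tendsto_const_nhds.div hden (by positivity)
    have hlt : Λ / (betaP P / 2) < M + 1 := by
      have : Λ / (betaP P / 2) = 2 * Λ / betaP P := by field_simp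
      linarith
    filter_upwards [hlim.eventually (gt_mem_nhds hlt), hden.eventually (lt_mem_nhds (half_pos hβ)),
      eventually_gt_atTop 0] with Q h1 h2 h3
    have hN : 0 < (fareySet P Q).card := by
      rcases Nat.eq_zero_or_pos (fareySet P Q).card with h | h
      · rw [h] at h2; simp at h2
      · exact h
    refine pf_le_U P Q M h3 Λ hΛ hN ?_
    rwa [div_div_eq_mul_div] at h1
  have hU : Tendsto (fun Q : ℕ => pfU M Λ (((fareySet P Q).card : ℝ) / (Q : ℝ) ^ 2) (1 / (Q : ℝ)))
      atTop (nhds (pfU M Λ (betaP P / 2) 0)) := by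
    unfold pfU
    refine (tendsto_const_nhds.div hden (by positivity)).mul ?_
    refine tendsto_finsetSum _ (fun m _ => tendsto_finsetSum _ (fun g _ => ?_))
    refine Tendsto.const_mul _ (Tendsto.add (Tendsto.const_mul _ ?_)
      (Tendsto.const_mul _ tendsto_one_div_atTop_nhds_zero_nat))
    exact (pfA_continuous.tendsto _).comp ((hden.const_mul _).div_const _)
  have hbdd : IsBoundedUnder (· ≤ ·) atTop (fun Q : ℕ => pairCorr (fareySet P Q) Λ) :=
    hU.isBoundedUnder_le.mono_le hev
  refine ⟨hbdd, ?_⟩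
  have hnn : ∀ Q : ℕ, 0 ≤ pairCorr (fareySet P Q) Λ := fun Q => by rw [pairCorr]; positivity
  have hcob : IsCoboundedUnder (· ≤ ·) atTop (fun Q : ℕ => pairCorr (fareySet P Q) Λ) :=
    (isBoundedUnder_of ⟨0, fun Q => hnn Q⟩ :
      IsBoundedUnder (· ≥ ·) atTop _).isCoboundedUnder_le
  refine (limsup_le_limsup hev hcob hU.isBoundedUnder_le).trans ?_
  rw [hU.limsup_eq, pf_corrSum_integral P hβ Λ hΛ M hM.le, one_mul, pfU, Finset.mul_sum]
  refine Finset.sum_le_sum (fun m hm => ?_)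
  have hm1 := (mem_Icc.1 hm).1
  have hm0 : (0 : ℝ) < m := by positivity
  have e : (m : ℝ) * betaP P / 2 / Λ = m * (betaP P / 2) / Λ := by ring
  rw [e]
  have hA : 0 ≤ pfA (m * (betaP P / 2) / Λ) := pfA_nonneg (by positivity)
  set z := pfA (m * (betaP P / 2) / Λ)
  have e2 : ∑ g ∈ m.divisors, (g : ℝ) * ((1 / (g : ℝ) ^ 2) * z + 2 / g * 0) =
      (∑ g ∈ m.divisors, (g : ℝ) * (1 / (g : ℝ) ^ 2)) * z := by
    rw [Finset.sum_mul]
    exact Finset.sum_congr rfl (fun g _ => by ring)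
  rw [e2]
  calc (1 / (betaP P / 2)) * ((∑ g ∈ m.divisors, (g : ℝ) * (1 / (g : ℝ) ^ 2)) * z)
      ≤ (1 / (betaP P / 2)) * ((hFun P m : ℝ) / m * z) := by
        gcongr
        exact pf_hFun P m hm1
    _ = _ := by field_simp
end
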